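/- arXiv:2202.11293 — 2 statements merged into one kernel-verified Lean document; each statement's English description precedes it below -/
import Mathlib

section
/- If α is a Liouville number, then cos α is transcendental. -/
open Finset
set_option linter.unusedSimpArgs false

theorem lc_inv_series {ι : Type} [DecidableEq ι] (S : Finset ι) (e : ι → ℤ) (d : ℕ)
    (he : ∀ i ∈ S, |e i| ≤ d) :
    ∃ g : PowerSeries ℤ, g * ∏ i ∈ S, (1 + PowerSeries.C (e i) * PowerSeries.X) = 1 ∧
      PowerSeries.coeff 0 g = 1 ∧ ∀ k, |PowerSeries.coeff k g| ≤ ((S.card : ℤ) * d) ^ k := by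
  induction S using Finset.induction_on with
  | empty =>
    refine ⟨1, by simp, by simp, fun k => ?_⟩
    rw [PowerSeries.coeff_one]
    split_ifs with h
    · simp [h]
    · simp [h]
  | insert a S ha ih =>
    obtain ⟨g, hg, hg0, hgk⟩ := ih (fun i hi => he i (mem_insert_of_mem hi))
    have hu : ∃ v : PowerSeries ℤ, v * (1 + PowerSeries.C (e a) * PowerSeries.X) = 1 := by
      refine ⟨PowerSeries.invOfUnit (1 + PowerSeries.C (e a) * PowerSeries.X) 1, ?_⟩
      rw [mul_comm]
      apply PowerSeries.mul_invOfUnit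
      simp
    obtain ⟨v, hv⟩ := hu
    have hrec : (g * v) * (1 + PowerSeries.C (e a) * PowerSeries.X) = g := by
      rw [mul_assoc, hv, mul_one]
    have h0 : PowerSeries.coeff 0 (g * v) = 1 := by
      have := congrArg (PowerSeries.coeff 0) hrec
      simpa [hg0] using this
    have hsucc : ∀ k, PowerSeries.coeff (k+1) (g * v)
        = PowerSeries.coeff (k+1) g - e a * PowerSeries.coeff k (g * v) := by
      intro k
      have := congrArg (PowerSeries.coeff (k+1)) hrec
      rw [mul_add, mul_one, map_add, mul_left_comm, PowerSeries.coeff_C_mul,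
        PowerSeries.coeff_succ_mul_X] at this
      linarith
    refine ⟨g * v, ?_, h0, ?_⟩
    · rw [prod_insert ha]
      calc _ = (g * ∏ i ∈ S, (1 + PowerSeries.C (e i) * PowerSeries.X)) *
            (v * (1 + PowerSeries.C (e a) * PowerSeries.X)) := by ring
        _ = 1 := by rw [hg, hv, one_mul]
    · intro k
      rw [card_insert_of_notMem ha]
      induction k with
      | zero => rw [h0]; simp
      | succ k ih =>
        rw [hsucc]
        have h1 := hgk (k+1)
        have h2 := he a (mem_insert_self _ _)
        have h3 : |e a * PowerSeries.coeff k (g * v)| ≤ d * ((((S.card + 1 : ℕ) : ℤ) * d) ^ k) := by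
          rw [abs_mul]; gcongr
        have h4 : ((S.card : ℤ) * d) ^ (k+1) ≤ (S.card : ℤ) * d * (((S.card + 1 : ℕ) : ℤ) * d) ^ k := by
          rw [pow_succ']; gcongr; simp
        calc _ ≤ |PowerSeries.coeff (k+1) g| + |e a * PowerSeries.coeff k (g * v)| := abs_sub _ _
          _ ≤ (S.card : ℤ) * d * (((S.card + 1 : ℕ) : ℤ) * d) ^ k + d * ((((S.card + 1 : ℕ) : ℤ) * d) ^ k) := by linarith
          _ = _ := by push_cast; ring

theorem lc_coeff_comp (p q : Polynomial ℚ) (m : ℕ) (hp : p.natDegree ≤ m) (hq : q.natDegree ≤ 1) :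
    (p.comp q).coeff m = p.coeff m * (q.coeff 1) ^ m := by
  rw [Polynomial.comp, Polynomial.eval₂_eq_sum_range' _ (Nat.lt_succ_of_le hp),
    Polynomial.finsetSum_coeff, Finset.sum_range_succ]
  rw [Finset.sum_eq_zero, zero_add, Polynomial.coeff_C_mul]
  · have := Polynomial.coeff_pow_of_natDegree_le (m := m) hq
    rw [mul_one] at this
    rw [this]
  · intro i hi
    rw [Polynomial.coeff_C_mul, Polynomial.coeff_eq_zero_of_natDegree_lt (p := q ^ i), mul_zero]
    have := Polynomial.natDegree_pow_le_of_le i hq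
    have := mem_range.1 hi
    omega

theorem lc_hermite_vanish (n m : ℕ) (d : ℚ) (hd : d ≠ 0) (G : ℕ → PowerSeries ℚ) (c : ℚ)

    (hG : ∀ h ≤ n, G h * (((∏ j ∈ (range (n+1)).erase h,
      (Polynomial.X - Polynomial.C (j : ℚ)) ^ (m+1)).comp
        (Polynomial.C d * Polynomial.X + Polynomial.C (h : ℚ)) : Polynomial ℚ) : PowerSeries ℚ)
        = PowerSeries.C c)
    (B : Polynomial ℚ) (hB : B.natDegree < m + n * (m+1)) :
    ∑ h ∈ range (n+1), PowerSeries.coeff m (G h * ((B.comp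
      (Polynomial.C d * Polynomial.X + Polynomial.C (h : ℚ)) : Polynomial ℚ) : PowerSeries ℚ)) = 0 := by
  classical
  set L : ℕ → Polynomial ℚ := fun h => Polynomial.C d * Polynomial.X + Polynomial.C (h : ℚ) with hL
  set L' : ℕ → Polynomial ℚ := fun h => Polynomial.C d⁻¹ * (Polynomial.X - Polynomial.C (h : ℚ)) with hL'
  set Q : ℕ → Polynomial ℚ := fun h => ∏ j ∈ (range (n+1)).erase h,
      (Polynomial.X - Polynomial.C (j : ℚ)) ^ (m+1) with hQ
  set s : ℕ → Polynomial ℚ := fun h =>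
    PowerSeries.trunc (m+1) (G h * (((B.comp (L h) : Polynomial ℚ)) : PowerSeries ℚ)) with hs
  have hLL' : ∀ h, (L' h).comp (L h) = Polynomial.X := by
    intro h
    simp only [hL, hL', Polynomial.mul_comp, Polynomial.sub_comp, Polynomial.C_comp, Polynomial.X_comp]
    rw [add_sub_cancel_right, ← mul_assoc, ← Polynomial.C_mul, inv_mul_cancel₀ hd]; simp
  have hL'L : ∀ h, (L h).comp (L' h) = Polynomial.X := by
    intro h
    simp only [hL, hL', Polynomial.mul_comp, Polynomial.add_comp, Polynomial.C_comp, Polynomial.X_comp]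
    rw [← mul_assoc, ← Polynomial.C_mul, mul_inv_cancel₀ hd]; simp
  have hsdeg : ∀ h, (s h).natDegree ≤ m := fun h =>
    Nat.lt_succ_iff.1 (PowerSeries.natDegree_trunc_lt _ _)
  have hL'deg : ∀ h, (L' h).natDegree ≤ 1 := by
    intro h
    simp only [hL']
    refine (Polynomial.natDegree_C_mul_le _ _).trans ?_
    rw [Polynomial.natDegree_X_sub_C]
  have hQmon : ∀ h, (Q h).Monic := fun h =>
    Polynomial.monic_prod_of_monic _ _ (fun j _ => (Polynomial.monic_X_sub_C _).pow _)
  have hQdeg : ∀ h ∈ range (n+1), (Q h).natDegree = n * (m+1) := by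
    intro h hh
    simp only [hQ]
    rw [Polynomial.natDegree_prod_of_monic _ _ (fun j _ => (Polynomial.monic_X_sub_C _).pow _)]
    simp only [Polynomial.natDegree_pow, Polynomial.natDegree_X_sub_C, sum_const, card_erase_of_mem hh,
      card_range]
    simp
  set T : Polynomial ℚ := ∑ h ∈ range (n+1), (s h).comp (L' h) * Q h - Polynomial.C c * B with hT
  have hcompdeg : ∀ h, ((s h).comp (L' h)).natDegree ≤ m := by
    intro h
    refine Polynomial.natDegree_comp_le.trans ?_
    calc _ ≤ m * 1 := Nat.mul_le_mul (hsdeg h) (hL'deg h)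
      _ = m := mul_one m
  have hTdeg : T.natDegree ≤ m + n * (m+1) := by
    rw [hT]
    refine (Polynomial.natDegree_sub_le_of_le (m := m + n * (m+1)) (n := m + n * (m+1)) ?_ ?_).trans
      (max_self _).le
    · refine Polynomial.natDegree_sum_le_of_forall_le _ _ (fun h hh => ?_)
      refine Polynomial.natDegree_mul_le.trans ?_
      rw [hQdeg h hh]
      have := hcompdeg h
      omega
    · exact (Polynomial.natDegree_C_mul_le _ _).trans hB.le
  have hdvd : ∀ h ∈ range (n+1), (Polynomial.X - Polynomial.C (h : ℚ)) ^ (m+1) ∣ T := by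
    intro h hh
    have hother : ∀ h' ∈ (range (n+1)).erase h,
        (Polynomial.X - Polynomial.C (h : ℚ)) ^ (m+1) ∣ (s h').comp (L' h') * Q h' := by
      intro h' hh'
      refine Dvd.dvd.mul_left ?_ _
      exact Finset.dvd_prod_of_mem (fun j : ℕ => (Polynomial.X - Polynomial.C (j : ℚ)) ^ (m+1))
        (mem_erase.2 ⟨(mem_erase.1 hh').1.symm, hh⟩)
    have hmain : (Polynomial.X - Polynomial.C (h : ℚ)) ^ (m+1) ∣ (s h).comp (L' h) * Q h - Polynomial.C c * B := by
      have h1 : (Polynomial.X : Polynomial ℚ) ^ (m+1) ∣ s h * (Q h).comp (L h) - Polynomial.C c * B.comp (L h) := by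
        rw [Polynomial.X_pow_dvd_iff]
        intro k hk
        rw [← Polynomial.coeff_coe]
        have h2 := hG h (Nat.lt_succ_iff.1 (mem_range.1 hh))
        have h3 : ((s h * (Q h).comp (L h) - Polynomial.C c * B.comp (L h) : Polynomial ℚ) : PowerSeries ℚ)
            = ((s h : PowerSeries ℚ) - G h * ((B.comp (L h) : Polynomial ℚ) : PowerSeries ℚ)) *
              (((Q h).comp (L h) : Polynomial ℚ) : PowerSeries ℚ) := by
          push_cast
          rw [← h2]
          ring
        rw [h3]
        have h4 : (PowerSeries.X : PowerSeries ℚ) ^ (m+1) ∣ ((s h : PowerSeries ℚ) - G h * ((B.comp (L h) : Polynomial ℚ) : PowerSeries ℚ)) *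
              (((Q h).comp (L h) : Polynomial ℚ) : PowerSeries ℚ) := by
          refine Dvd.dvd.mul_right ?_ _
          rw [PowerSeries.X_pow_dvd_iff]
          intro i hi
          rw [map_sub, Polynomial.coeff_coe, hs]
          simp only
          rw [PowerSeries.coeff_trunc, if_pos hi, sub_self]
        rw [PowerSeries.X_pow_dvd_iff] at h4
        exact h4 k hk
      obtain ⟨r, hr⟩ := h1
      have h5 := congrArg (fun p => p.comp (L' h)) hr
      simp only [Polynomial.sub_comp, Polynomial.mul_comp, Polynomial.comp_assoc, hL'L, Polynomial.comp_X,
        Polynomial.C_comp, Polynomial.pow_comp, Polynomial.X_comp] at h5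
      rw [h5]
      simp only [hL', mul_pow]
      exact Dvd.dvd.mul_right (Dvd.intro_left _ rfl) _
    rw [hT, ← Finset.add_sum_erase _ _ hh, add_sub_right_comm]
    exact dvd_add hmain (Finset.dvd_sum hother)
  have hT0 : T = 0 := by
    have hprod : (∏ h ∈ range (n+1), (Polynomial.X - Polynomial.C (h : ℚ)) ^ (m+1)) ∣ T := by
      refine Finset.prod_dvd_of_coprime ?_ hdvd
      intro i _ j _ hij
      refine IsCoprime.pow ?_
      refine Polynomial.isCoprime_X_sub_C_of_isUnit_sub ?_
      refine (sub_ne_zero.2 ?_).isUnit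
      exact_mod_cast hij
    by_contra hne
    have := Polynomial.natDegree_le_of_dvd hprod hne
    rw [Polynomial.natDegree_prod_of_monic _ _ (fun j _ => (Polynomial.monic_X_sub_C _).pow _)] at this
    simp only [Polynomial.natDegree_pow, Polynomial.natDegree_X_sub_C, sum_const, card_range] at this
    simp only [smul_eq_mul, mul_one] at this
    nlinarith
  have hcoeff := congrArg (fun p => Polynomial.coeff p (m + n * (m+1))) hT0
  simp only [hT, Polynomial.coeff_sub, Polynomial.finsetSum_coeff, Polynomial.coeff_zero,
    Polynomial.coeff_C_mul] at hcoeff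
  rw [Polynomial.coeff_eq_zero_of_natDegree_lt hB, mul_zero, sub_zero] at hcoeff
  have hterm : ∀ h ∈ range (n+1), ((s h).comp (L' h) * Q h).coeff (m + n * (m+1)) =
      (d⁻¹) ^ m * PowerSeries.coeff m (G h * ((B.comp (L h) : Polynomial ℚ) : PowerSeries ℚ)) := by
    intro h hh
    rw [Polynomial.coeff_mul_add_eq_of_natDegree_le (hcompdeg h) (hQdeg h hh).le]
    rw [lc_coeff_comp _ _ m (hsdeg h) (hL'deg h)]
    have h1 : (Q h).coeff (n * (m+1)) = 1 := by
      rw [← hQdeg h hh]; exact hQmon h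
    have h2 : (L' h).coeff 1 = d⁻¹ := by
      simp [hL']
    rw [h1, h2, mul_one, mul_comm, hs]
    simp only
    rw [PowerSeries.coeff_trunc, if_pos (Nat.lt_succ_self m)]
  rw [Finset.sum_congr rfl hterm, ← Finset.mul_sum] at hcoeff
  rcases mul_eq_zero.1 hcoeff with h | h
  · exact absurd h (pow_ne_zero _ (inv_ne_zero hd))
  · exact h


theorem lc_prod_nodes (h r : ℕ) : ∏ j ∈ (range (h + r + 1)).erase h, ((h : ℤ) - j) =
    (-1) ^ r * (h.factorial * r.factorial : ℕ) := by
  induction r with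
  | zero =>
    have : (range (h + 0 + 1)).erase h = range h := by
      ext x; simp; omega
    rw [this]
    have h1 : ∀ h : ℕ, ∏ j ∈ range h, ((h : ℤ) - j) = h.factorial := by
      intro h
      induction h with
      | zero => simp
      | succ h ih =>
        rw [Finset.prod_range_succ', Nat.factorial_succ]
        push_cast
        rw [← ih, mul_comm]
        simp
    rw [h1]; simp
  | succ r ih =>
    have : (range (h + (r + 1) + 1)).erase h = insert (h + r + 1) ((range (h + r + 1)).erase h) := by
      ext x; simp; omega
    rw [this, Finset.prod_insert (by simp), ih, Nat.factorial_succ]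
    push_cast
    ring

theorem lc_exists_tau (n h : ℕ) (hh : h ≤ n) : ∃ τ : ℤ, |τ| ≤ 2 ^ n ∧ τ ≠ 0 ∧
    τ * ∏ j ∈ (range (n + 1)).erase h, ((h : ℤ) - j) = n.factorial := by
  obtain ⟨r, rfl⟩ := Nat.exists_eq_add_of_le hh
  refine ⟨(-1) ^ r * ((h + r).choose h : ℤ), ?_, ?_, ?_⟩
  · rw [abs_mul, abs_pow, abs_neg, abs_one, one_pow, one_mul, Nat.abs_cast]
    exact_mod_cast Nat.choose_le_two_pow _ _
  · have := (Nat.choose_pos hh).ne'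
    simp [this]
  · rw [lc_prod_nodes]
    have h1 := Nat.choose_mul_factorial_mul_factorial hh
    rw [Nat.add_sub_cancel_left] at h1
    rw [← h1]
    have h2 : ((-1 : ℤ)) ^ r * (-1) ^ r = 1 := by rw [← mul_pow]; simp
    push_cast
    linear_combination ((h + r).choose h : ℤ) * h.factorial * r.factorial * h2

theorem lc_exists_b (n m d : ℕ) (hn : 1 ≤ n) (hd : 0 < d) (hdiv : ∀ j, 1 ≤ j → j ≤ n → j ∣ d) :
    ∃ b : ℕ → Polynomial ℤ, (∀ h, (b h).natDegree ≤ m) ∧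
      (∀ h ∈ range (n+1), ∀ k, |(b h).coeff k| ≤
        (2 ^ n) ^ (m+1) * m.factorial * d ^ m * ((n * (m+1) : ℕ) : ℤ) ^ m) ∧
      (b 0).coeff m ≠ 0 ∧
      ∀ l < m + n * (m+1), ∑ h ∈ range (n+1), ∑ k ∈ range (m+1),
        (b h).coeff k * (l.descFactorial k : ℤ) * (h : ℤ) ^ (l - k) = 0 := by
  classical
  have hτ : ∀ h : ℕ, ∃ τ : ℤ, h ≤ n → (|τ| ≤ 2 ^ n ∧ τ ≠ 0 ∧
      τ * ∏ j ∈ (range (n + 1)).erase h, ((h : ℤ) - j) = n.factorial) := by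
    intro h
    by_cases hh : h ≤ n
    · obtain ⟨τ, h1⟩ := lc_exists_tau n h hh
      exact ⟨τ, fun _ => h1⟩
    · exact ⟨0, fun h => absurd h hh⟩
  choose τ hτ using hτ
  have hdvd : ∀ h j : ℕ, h ≤ n → j ≤ n → h ≠ j → ((h : ℤ) - j) ∣ d := by
    intro h j hh hj hne
    rw [← Int.natAbs_dvd_natAbs, Int.natAbs_natCast]
    apply hdiv <;> omega
  have hg : ∀ h : ℕ, ∃ g : PowerSeries ℤ, h ≤ n →
      (g * ∏ j ∈ (range (n+1)).erase h, (1 + PowerSeries.C ((d : ℤ) / ((h : ℤ) - j)) * PowerSeries.X) ^ (m+1) = 1 ∧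
      PowerSeries.coeff 0 g = 1 ∧ ∀ k, |PowerSeries.coeff k g| ≤ (((n * (m+1) : ℕ) : ℤ) * d) ^ k) := by
    intro h
    by_cases hh : h ≤ n
    · obtain ⟨g, h1, h2, h3⟩ := lc_inv_series (((range (n+1)).erase h) ×ˢ (range (m+1)))
        (fun x => (d : ℤ) / ((h : ℤ) - x.1)) d (by
          rintro ⟨j, i⟩ hx
          simp only [mem_product, mem_erase, mem_range] at hx
          simp only
          have h4 := hdvd h j hh (by omega) (by omega)
          obtain ⟨c, hc⟩ := h4
          have hne : (h : ℤ) - j ≠ 0 := by omega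
          rw [hc, Int.mul_ediv_cancel_left _ hne]
          calc |c| = 1 * |c| := (one_mul _).symm
            _ ≤ |(h : ℤ) - j| * |c| := by
              gcongr; exact Int.one_le_abs hne
            _ = |(d : ℤ)| := by rw [hc, abs_mul]
            _ = d := Nat.abs_cast _
            _ = _ := hc)
      refine ⟨g, fun _ => ⟨?_, h2, ?_⟩⟩
      · rw [Finset.prod_product] at h1
        simpa using h1
      · rw [card_product, card_erase_of_mem (mem_range.2 (by omega)), card_range, card_range] at h3
        simpa using h3
    · exact ⟨0, fun h => absurd h hh⟩
  choose g hg using hg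
  set b : ℕ → Polynomial ℤ := fun h => ∑ k ∈ range (m+1), Polynomial.monomial k
    (τ h ^ (m+1) * (m.descFactorial (m-k) : ℤ) * (d : ℤ) ^ k * PowerSeries.coeff (m-k) (g h)) with hb
  have hbc : ∀ h k, (b h).coeff k = if k < m + 1 then
      τ h ^ (m+1) * (m.descFactorial (m-k) : ℤ) * (d : ℤ) ^ k * PowerSeries.coeff (m-k) (g h) else 0 := by
    intro h k
    simp only [hb, Polynomial.finsetSum_coeff, Polynomial.coeff_monomial]
    rw [Finset.sum_ite_eq']
    simp
  refine ⟨b, ?_, ?_, ?_, ?_⟩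
  · intro h
    refine Polynomial.natDegree_sum_le_of_forall_le _ _ (fun k hk => ?_)
    exact (Polynomial.natDegree_monomial_le _).trans (by simpa [Nat.lt_succ_iff] using hk)
  · intro h hh k
    have hh' : h ≤ n := by simpa [Nat.lt_succ_iff] using hh
    rw [hbc]
    split_ifs with hk
    · obtain ⟨h1, -, -⟩ := hτ h hh'
      obtain ⟨-, -, h3⟩ := hg h hh'
      rw [abs_mul, abs_mul, abs_mul, abs_pow, abs_pow, Nat.abs_cast, Nat.abs_cast]
      have h4 : (m.descFactorial (m-k) : ℤ) ≤ m.factorial := by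
        have := Nat.factorial_mul_descFactorial (n := m) (k := m-k) (Nat.sub_le _ _)
        have h5 := Nat.factorial_pos (m - (m-k))
        exact_mod_cast this ▸ Nat.le_mul_of_pos_left _ h5
      calc _ ≤ (2 ^ n) ^ (m+1) * (m.factorial : ℤ) * (d : ℤ) ^ k * (((n * (m+1) : ℕ) : ℤ) * d) ^ (m-k) := by
            gcongr; exact h3 _
        _ = (2 ^ n) ^ (m+1) * (m.factorial : ℤ) * (d : ℤ) ^ m * ((n * (m+1) : ℕ) : ℤ) ^ (m-k) := by
            have : (d : ℤ) ^ m = d ^ k * d ^ (m-k) := by rw [← pow_add]; congr 1; omega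
            rw [this, mul_pow]; ring
        _ ≤ _ := by
            gcongr
            · have : 0 < n * (m+1) := by positivity
              exact_mod_cast this
            · omega
    · rw [abs_zero]; positivity
  · rw [hbc, if_pos (Nat.lt_succ_self m)]
    obtain ⟨-, h1, -⟩ := hτ 0 (Nat.zero_le _)
    obtain ⟨-, h2, -⟩ := hg 0 (Nat.zero_le _)
    rw [Nat.sub_self, h2]
    simp [h1, hd.ne']
  · intro l hl
    have key := lc_hermite_vanish n m d (by exact_mod_cast hd.ne')
      (fun h => PowerSeries.map (Int.castRingHom ℚ) (PowerSeries.C (τ h ^ (m+1)) * g h))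
      (((n.factorial : ℤ) ^ (m+1) : ℤ) : ℚ) (by
        intro h hh
        obtain ⟨-, -, h1⟩ := hτ h hh
        obtain ⟨h2, -, -⟩ := hg h hh
        have h3 : (((∏ j ∈ (range (n+1)).erase h, (Polynomial.X - Polynomial.C (j : ℚ)) ^ (m+1)).comp
            (Polynomial.C (d : ℚ) * Polynomial.X + Polynomial.C (h : ℚ)) : Polynomial ℚ) : PowerSeries ℚ)
            = PowerSeries.map (Int.castRingHom ℚ) (PowerSeries.C ((∏ j ∈ (range (n + 1)).erase h, ((h : ℤ) - j)) ^ (m+1)) *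
              ∏ j ∈ (range (n+1)).erase h, (1 + PowerSeries.C ((d : ℤ) / ((h : ℤ) - j)) * PowerSeries.X) ^ (m+1)) := by
          rw [map_pow, map_prod, ← Finset.prod_pow, ← Finset.prod_mul_distrib, map_prod, Polynomial.prod_comp,
            ← Polynomial.coeToPowerSeries.ringHom_apply, map_prod]
          refine Finset.prod_congr rfl (fun j hj => ?_)
          rw [← mul_pow, Polynomial.pow_comp, map_pow, map_pow]
          congr 1
          simp only [mem_erase, mem_range] at hj
          obtain ⟨c, hc⟩ := hdvd h j hh (by omega) (by omega)
          have hne : (h : ℤ) - j ≠ 0 := by omega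
          rw [hc, Int.mul_ediv_cancel_left _ hne]
          have hc' : (d : ℚ) = ((h : ℚ) - j) * c := by exact_mod_cast hc
          rw [hc']
          simp only [Polynomial.sub_comp, Polynomial.X_comp, Polynomial.C_comp, Polynomial.natCast_comp, Polynomial.coeToPowerSeries.ringHom_apply, map_mul, map_add, map_one, PowerSeries.map_C, PowerSeries.map_X, Polynomial.coe_sub, Polynomial.coe_add, Polynomial.coe_mul, Polynomial.coe_C, Polynomial.coe_X, map_sub, map_natCast, eq_intCast, map_intCast]
          try push_cast
          ring
        rw [h3, ← map_mul, ← h1]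
        have h4 : PowerSeries.C (τ h ^ (m+1)) * g h * (PowerSeries.C ((∏ j ∈ (range (n + 1)).erase h, ((h : ℤ) - j)) ^ (m+1)) *
              ∏ j ∈ (range (n+1)).erase h, (1 + PowerSeries.C ((d : ℤ) / ((h : ℤ) - j)) * PowerSeries.X) ^ (m+1))
            = PowerSeries.C ((τ h * ∏ j ∈ (range (n + 1)).erase h, ((h : ℤ) - j)) ^ (m+1)) := by
          rw [mul_pow, map_mul, mul_mul_mul_comm, h2, mul_one]
        rw [h4, PowerSeries.map_C, eq_intCast])
      (Polynomial.X ^ l) (by rw [Polynomial.natDegree_X_pow]; exact hl)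
    have hcoef : ∀ h k : ℕ, ((((Polynomial.X : Polynomial ℚ) ^ l).comp
        (Polynomial.C (d : ℚ) * Polynomial.X + Polynomial.C (h : ℚ)))).coeff k =
        (d : ℚ) ^ k * (h : ℚ) ^ (l-k) * l.choose k := by
      intro h k
      have h1 : ((Polynomial.X : Polynomial ℚ) ^ l).comp
        (Polynomial.C (d : ℚ) * Polynomial.X + Polynomial.C (h : ℚ)) =
        ((Polynomial.X + Polynomial.C (h : ℚ)) ^ l).comp (Polynomial.C (d : ℚ) * Polynomial.X) := by
        simp only [Polynomial.pow_comp, Polynomial.X_comp, Polynomial.add_comp, Polynomial.C_comp]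
      rw [h1, Polynomial.comp_C_mul_X_coeff, Polynomial.coeff_X_add_C_pow]
      ring
    have hfin : ((∑ h ∈ range (n+1), ∑ k ∈ range (m+1),
        (b h).coeff k * (l.descFactorial k : ℤ) * (h : ℤ) ^ (l - k) : ℤ) : ℚ) = (m.factorial : ℚ) * 0 := by
      rw [← key, Finset.mul_sum, Int.cast_sum]
      refine Finset.sum_congr rfl (fun h _ => ?_)
      rw [mul_comm (PowerSeries.map _ _), PowerSeries.coeff_mul, Finset.Nat.sum_antidiagonal_eq_sum_range_succ_mk,
        Finset.mul_sum, Int.cast_sum]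
      refine Finset.sum_congr rfl (fun k hk => ?_)
      have hk' := mem_range.1 hk
      rw [hbc, if_pos hk', Polynomial.coeff_coe, hcoef, PowerSeries.coeff_map, PowerSeries.coeff_C_mul]
      have h5 := Nat.factorial_mul_descFactorial (n := m) (k := m-k) (Nat.sub_le _ _)
      rw [Nat.sub_sub_self (by omega)] at h5
      rw [← h5, Nat.descFactorial_eq_factorial_mul_choose l k]
      simp only [eq_intCast]
      push_cast
      ring
    rw [mul_zero] at hfin
    exact_mod_cast hfin


noncomputable def lcD (b : ℕ → Polynomial ℤ) : ℕ → Polynomial ℤ :=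
  fun h => Polynomial.C (h : ℤ) * b h + Polynomial.derivative (b h)

def lcC (n m : ℕ) (b : ℕ → Polynomial ℤ) (l : ℕ) : ℤ :=
  ∑ h ∈ range (n+1), ∑ k ∈ range (m+1), (b h).coeff k * (l.descFactorial k : ℤ) * (h : ℤ) ^ (l - k)

noncomputable def lcF (n : ℕ) (b : ℕ → Polynomial ℤ) (z x : ℂ) : ℂ :=
  ∑ h ∈ range (n+1), Polynomial.aeval z (b h) * x ^ h

theorem lcD_coeff (b : ℕ → Polynomial ℤ) (h k : ℕ) :
    (lcD b h).coeff k = h * (b h).coeff k + (k + 1) * (b h).coeff (k+1) := by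
  simp only [lcD, Polynomial.coeff_add, Polynomial.coeff_C_mul, Polynomial.coeff_derivative]
  ring

theorem lcD_natDegree (b : ℕ → Polynomial ℤ) (m : ℕ) (hb : ∀ h, (b h).natDegree ≤ m) (h : ℕ) :
    (lcD b h).natDegree ≤ m := by
  rw [Polynomial.natDegree_le_iff_coeff_eq_zero]
  intro k hk
  rw [lcD_coeff, Polynomial.coeff_eq_zero_of_natDegree_lt ((hb h).trans_lt hk),
    Polynomial.coeff_eq_zero_of_natDegree_lt ((hb h).trans_lt (Nat.lt_succ_of_lt hk))]
  simp

theorem lcD_bound (b : ℕ → Polynomial ℤ) (n m : ℕ) (hb : ∀ h, (b h).natDegree ≤ m) (H : ℤ) (hH : 0 ≤ H)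
    (hbH : ∀ h ∈ range (n+1), ∀ k, |(b h).coeff k| ≤ H) :
    ∀ h ∈ range (n+1), ∀ k, |(lcD b h).coeff k| ≤ ((n + m : ℕ) : ℤ) * H := by
  intro h hh k
  rw [lcD_coeff]
  have h1 : |(h : ℤ) * (b h).coeff k| ≤ n * H := by
    rw [abs_mul, Nat.abs_cast]
    have : h ≤ n := by simpa [Nat.lt_succ_iff] using hh
    gcongr
    exact hbH h hh k
  have h2 : |((k : ℤ) + 1) * (b h).coeff (k+1)| ≤ m * H := by
    by_cases hk : k + 1 ≤ m
    · rw [abs_mul]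
      have h3 : |(k : ℤ) + 1| ≤ m := by
        rw [abs_of_nonneg (by positivity)]; exact_mod_cast hk
      gcongr
      exact hbH h hh _
    · rw [Polynomial.coeff_eq_zero_of_natDegree_lt ((hb h).trans_lt (by omega))]
      simp only [mul_zero, abs_zero]
      positivity
  calc _ ≤ _ := abs_add_le _ _
    _ ≤ n * H + m * H := add_le_add h1 h2
    _ = _ := by push_cast; ring

theorem lcD_vanish (b : ℕ → Polynomial ℤ) (n m : ℕ) (hb : ∀ h, (b h).natDegree ≤ m) (l : ℕ) :
    lcC n m (lcD b) l = lcC n m b (l+1) := by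
  unfold lcC
  refine Finset.sum_congr rfl (fun h _ => ?_)
  set f : ℕ → ℤ := fun k => k * (b h).coeff k * (l.descFactorial (k-1) : ℤ) * (h : ℤ) ^ (l + 1 - k) with hf
  have h1 : ∑ k ∈ range (m+1), f (k+1) = ∑ k ∈ range (m+1), f k := by
    have h2 := Finset.sum_range_succ' f (m+1)
    have h3 := Finset.sum_range_succ f (m+1)
    have h4 : f 0 = 0 := by simp [hf]
    have h5 : f (m+1) = 0 := by
      simp only [hf]
      rw [Polynomial.coeff_eq_zero_of_natDegree_lt ((hb h).trans_lt (Nat.lt_succ_self m))]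
      simp
    linarith
  have h6 : ∀ k, (lcD b h).coeff k * (l.descFactorial k : ℤ) * (h : ℤ) ^ (l - k) =
      h * (b h).coeff k * (l.descFactorial k : ℤ) * (h : ℤ) ^ (l - k) + f (k+1) := by
    intro k
    rw [lcD_coeff]
    simp only [hf, Nat.add_sub_cancel, Nat.add_sub_add_right]
    push_cast
    ring
  rw [Finset.sum_congr rfl (fun k _ => h6 k), Finset.sum_add_distrib, h1, ← Finset.sum_add_distrib]
  refine Finset.sum_congr rfl (fun k _ => ?_)
  simp only [hf]
  rcases k with _ | k
  · simp [pow_succ]; ring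
  · rw [Nat.succ_descFactorial_succ, Nat.add_sub_cancel, Nat.add_sub_add_right]
    rcases lt_trichotomy l k with h7 | h7 | h7
    · rw [Nat.descFactorial_eq_zero_iff_lt.2 h7, Nat.descFactorial_eq_zero_iff_lt.2 (h7.trans (Nat.lt_succ_self k))]
      simp
    · subst h7
      rw [Nat.descFactorial_eq_zero_iff_lt.2 (Nat.lt_succ_self l)]
      push_cast
      ring
    · rw [Nat.descFactorial_succ]
      obtain ⟨r, rfl⟩ := Nat.exists_eq_add_of_lt h7
      have e1 : k + r + 1 - k = r + 1 := by omega
      have e2 : k + r + 1 - (k + 1) = r := by omega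
      rw [e1, e2, pow_succ]
      push_cast
      ring

theorem lcD_iter (b : ℕ → Polynomial ℤ) (n m : ℕ) (hb : ∀ h, (b h).natDegree ≤ m) (H : ℤ) (hH : 0 ≤ H)
    (hbH : ∀ h ∈ range (n+1), ∀ k, |(b h).coeff k| ≤ H) (j : ℕ) :
    (∀ h, (lcD^[j] b h).natDegree ≤ m) ∧
    (∀ h ∈ range (n+1), ∀ k, |(lcD^[j] b h).coeff k| ≤ ((n + m : ℕ) : ℤ) ^ j * H) ∧
    (∀ l, lcC n m (lcD^[j] b) l = lcC n m b (l+j)) ∧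
    lcD^[j] b 0 = Polynomial.derivative^[j] (b 0) := by
  induction j with
  | zero => exact ⟨hb, by simpa only [pow_zero, one_mul, Function.iterate_zero, id_eq] using hbH, fun _ => rfl, rfl⟩
  | succ j ih =>
    obtain ⟨h1, h2, h3, h4⟩ := ih
    rw [Function.iterate_succ_apply', Function.iterate_succ_apply']
    refine ⟨lcD_natDegree _ _ h1, ?_, ?_, ?_⟩
    · intro h hh k
      have := lcD_bound _ n m h1 _ (by positivity) h2 h hh k
      rw [pow_succ', mul_assoc]
      exact this
    · intro l
      rw [lcD_vanish _ _ _ h1, h3]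
      congr 1; omega
    · rw [← h4]
      simp [lcD]

noncomputable def lcTail (r : ℕ) (w : ℂ) : ℂ := Complex.exp w - ∑ i ∈ range r, w ^ i / (i.factorial : ℂ)

theorem lcF_eq_tail (b : ℕ → Polynomial ℤ) (n m N : ℕ) (hb : ∀ h, (b h).natDegree ≤ m) (hmN : m ≤ N)
    (hv : ∀ l < N, lcC n m b l = 0) (z : ℂ) :
    lcF n b z (Complex.exp z) = ∑ h ∈ range (n+1), ∑ k ∈ range (m+1),
      ((b h).coeff k : ℂ) * z ^ k * lcTail (N - k) (h * z) := by
  have h0 : ∑ h ∈ range (n+1), ∑ k ∈ range (m+1),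
      ((b h).coeff k : ℂ) * z ^ k * ∑ i ∈ range (N - k), ((h : ℂ) * z) ^ i / (i.factorial : ℂ) = 0 := by
    have h1 : ∀ h k : ℕ, k ≤ m → ((b h).coeff k : ℂ) * z ^ k * ∑ i ∈ range (N - k), ((h : ℂ) * z) ^ i / (i.factorial : ℂ)
        = ∑ l ∈ range N, (z ^ l / (l.factorial : ℂ)) *
          (((b h).coeff k * (l.descFactorial k : ℤ) * (h : ℤ) ^ (l - k) : ℤ) : ℂ) := by
      intro h k hk
      obtain ⟨r, rfl⟩ := Nat.exists_eq_add_of_le (hk.trans hmN)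
      rw [Finset.sum_range_add, Finset.sum_eq_zero (s := range k), zero_add, Nat.add_sub_cancel_left, Finset.mul_sum]
      · refine Finset.sum_congr rfl (fun i _ => ?_)
        have h2 := Nat.factorial_mul_descFactorial (n := k + i) (k := k) (Nat.le_add_right _ _)
        rw [Nat.add_sub_cancel_left] at h2
        rw [← h2, Nat.add_sub_cancel_left]
        have h3 : (i.factorial : ℂ) ≠ 0 := by exact_mod_cast i.factorial_ne_zero
        have h4 : ((k+i).descFactorial k : ℂ) ≠ 0 := by
          have : (k+i).descFactorial k ≠ 0 := by
            rw [Ne, Nat.descFactorial_eq_zero_iff_lt]; omega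
          exact_mod_cast this
        push_cast
        field_simp
        ring
      · intro l hl
        rw [Nat.descFactorial_eq_zero_iff_lt.2 (mem_range.1 hl)]
        simp
    calc _ = ∑ h ∈ range (n+1), ∑ k ∈ range (m+1), ∑ l ∈ range N, (z ^ l / (l.factorial : ℂ)) *
          (((b h).coeff k * (l.descFactorial k : ℤ) * (h : ℤ) ^ (l - k) : ℤ) : ℂ) := by
          refine Finset.sum_congr rfl (fun h _ => Finset.sum_congr rfl (fun k hk => ?_))
          exact h1 h k (by simpa [Nat.lt_succ_iff] using hk)
      _ = ∑ l ∈ range N, (z ^ l / (l.factorial : ℂ)) * ((lcC n m b l : ℤ) : ℂ) := by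
          simp only [lcC, Int.cast_sum, Finset.mul_sum]
          rw [Finset.sum_comm (s := range N)]
          refine Finset.sum_congr rfl (fun h _ => ?_)
          rw [Finset.sum_comm]
      _ = 0 := by
          refine Finset.sum_eq_zero (fun l hl => ?_)
          rw [hv l (mem_range.1 hl)]; simp
  rw [← sub_zero (lcF _ _ _ _), ← h0, lcF, ← Finset.sum_sub_distrib]
  refine Finset.sum_congr rfl (fun h _ => ?_)
  rw [Polynomial.aeval_eq_sum_range' (Nat.lt_succ_of_le (hb h)), Finset.sum_mul, ← Finset.sum_sub_distrib]
  refine Finset.sum_congr rfl (fun k _ => ?_)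
  rw [lcTail, ← Complex.exp_nat_mul]
  simp only [zsmul_eq_mul]
  ring

theorem lcTail_bound1 (r : ℕ) (w : ℂ) : ‖lcTail r w‖ ≤ ‖w‖ ^ r * Real.exp ‖w‖ :=
  Complex.norm_exp_sub_sum_le_norm_mul_exp w r

theorem lcTail_bound2 (r : ℕ) (w : ℂ) (t : ℝ) (ht : 1 ≤ t) : ‖lcTail r w‖ ≤ Real.exp (t * ‖w‖) / t ^ r := by
  refine (Complex.norm_exp_sub_sum_le_exp_norm_sub_sum w r).trans ?_
  set x := ‖w‖
  have hx : 0 ≤ x := norm_nonneg w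
  have hs : ∀ y : ℝ, HasSum (fun i : ℕ => y ^ (i + r) / ((i + r).factorial : ℝ))
      (Real.exp y - ∑ i ∈ range r, y ^ i / (i.factorial : ℝ)) := by
    intro y
    have := NormedSpace.expSeries_div_hasSum_exp (𝔸 := ℝ) y
    rw [← Real.exp_eq_exp_ℝ] at this
    exact (hasSum_nat_add_iff' r).2 this
  have h1 := hs x
  have h2 := (hs (t * x)).mul_left (1 / t ^ r)
  have ht0 : 0 < t := by linarith
  have h3 := hasSum_le (fun i => ?_) h1 h2
  · refine h3.trans ?_
    rw [div_eq_mul_one_div (Real.exp _), mul_comm (Real.exp _)]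
    gcongr
    have : 0 ≤ ∑ i ∈ range r, (t * x) ^ i / (i.factorial : ℝ) :=
      Finset.sum_nonneg (fun i _ => by positivity)
    linarith
  · have h4 : (1 : ℝ) ≤ t ^ i := one_le_pow₀ ht
    rw [mul_pow, pow_add t]
    have h5 : 1 / t ^ r * (t ^ i * t ^ r * x ^ (i + r) / ((i + r).factorial : ℝ)) =
      t ^ i * (x ^ (i + r) / ((i + r).factorial : ℝ)) := by
      field_simp
    rw [h5]
    exact le_mul_of_one_le_left (by positivity) h4


theorem lc_dvd_of_isBigO (p : Polynomial ℂ) (hp : p ≠ 0) (N : ℕ)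
    (hO : (fun z : ℂ => p.eval (Complex.exp z)) =O[nhds 0] (fun z => z ^ N)) :
    (Polynomial.X - Polynomial.C 1) ^ N ∣ p := by
  obtain ⟨s, hs, hnd⟩ := Polynomial.exists_eq_pow_rootMultiplicity_mul_and_not_dvd p hp 1
  set r := p.rootMultiplicity 1
  by_cases hr : N ≤ r
  · rw [hs]
    exact Dvd.dvd.mul_right (pow_dvd_pow _ hr) _
  exfalso
  push Not at hr
  have hs1 : s.eval 1 ≠ 0 := by
    intro h
    exact hnd (Polynomial.dvd_iff_isRoot.2 h)
  have hder : HasDerivAt Complex.exp 1 0 := by simpa using Complex.hasDerivAt_exp 0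
  have hlim : Filter.Tendsto (fun z : ℂ => z⁻¹ * (Complex.exp z - 1)) (nhdsWithin 0 {0}ᶜ) (nhds 1) := by
    have := hasDerivAt_iff_tendsto_slope_zero.1 hder
    simpa using this
  have hcont : Filter.Tendsto (fun z : ℂ => s.eval (Complex.exp z)) (nhdsWithin 0 {0}ᶜ) (nhds (s.eval 1)) := by
    have h1 : Continuous (fun z : ℂ => s.eval (Complex.exp z)) := s.continuous.comp Complex.continuous_exp
    have h2 := h1.tendsto 0
    simp only [Complex.exp_zero] at h2
    exact h2.mono_left nhdsWithin_le_nhds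
  have h3 : Filter.Tendsto (fun z : ℂ => (z⁻¹ * (Complex.exp z - 1)) ^ r * s.eval (Complex.exp z))
      (nhdsWithin 0 {0}ᶜ) (nhds (1 ^ r * s.eval 1)) := (hlim.pow r).mul hcont
  rw [one_pow, one_mul] at h3
  have h4 : Filter.Tendsto (fun z : ℂ => (z⁻¹ * (Complex.exp z - 1)) ^ r * s.eval (Complex.exp z))
      (nhdsWithin 0 {0}ᶜ) (nhds 0) := by
    obtain ⟨K, hK⟩ := hO.bound
    have hK' := hK.filter_mono (nhdsWithin_le_nhds (s := ({0} : Set ℂ)ᶜ))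
    have h5 : Filter.Tendsto (fun z : ℂ => K * ‖z‖ ^ (N - r)) (nhdsWithin 0 {0}ᶜ) (nhds 0) := by
      have : Continuous (fun z : ℂ => K * ‖z‖ ^ (N - r)) := by fun_prop
      have h6 := this.tendsto 0
      rw [norm_zero, zero_pow (by omega), mul_zero] at h6
      exact h6.mono_left nhdsWithin_le_nhds
    refine squeeze_zero_norm' ?_ h5
    filter_upwards [hK', self_mem_nhdsWithin] with z hz hz0
    have hz0' : z ≠ 0 := hz0
    have h7 : (z⁻¹ * (Complex.exp z - 1)) ^ r * s.eval (Complex.exp z) = (z ^ r)⁻¹ * p.eval (Complex.exp z) := by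
      rw [hs]
      simp only [Polynomial.eval_mul, Polynomial.eval_pow, Polynomial.eval_sub, Polynomial.eval_X, Polynomial.eval_C]
      rw [mul_pow, inv_pow]; ring
    rw [h7, norm_mul, norm_inv, norm_pow]
    rw [norm_pow] at hz
    have hzp : 0 < ‖z‖ := norm_pos_iff.2 hz0'
    calc _ ≤ (‖z‖ ^ r)⁻¹ * (K * ‖z‖ ^ N) := by gcongr
      _ = K * ‖z‖ ^ (N - r) := by
        have : ‖z‖ ^ N = ‖z‖ ^ r * ‖z‖ ^ (N - r) := by rw [← pow_add]; congr 1; omega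
        rw [this]
        field_simp
  exact hs1 (tendsto_nhds_unique h3 h4)

theorem lcF_isBigO (b : ℕ → Polynomial ℤ) (n m N : ℕ) (hb : ∀ h, (b h).natDegree ≤ m) (hmN : m ≤ N)
    (hv : ∀ l < N, lcC n m b l = 0) :
    (fun z : ℂ => lcF n b z (Complex.exp z)) =O[nhds 0] (fun z => z ^ N) := by
  have h1 : (fun z : ℂ => lcF n b z (Complex.exp z)) = fun z => ∑ h ∈ range (n+1), ∑ k ∈ range (m+1),
      ((b h).coeff k : ℂ) * z ^ k * lcTail (N - k) (h * z) := by
    funext z; exact lcF_eq_tail b n m N hb hmN hv z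
  rw [h1]
  refine Asymptotics.IsBigO.fun_sum (fun h _ => Asymptotics.IsBigO.fun_sum (fun k hk => ?_))
  have hk' : k ≤ N := (by simpa [Nat.lt_succ_iff] using hk : k ≤ m).trans hmN
  have h2 : (fun z : ℂ => lcTail (N - k) (h * z)) =O[nhds 0] (fun z => z ^ (N - k)) := by
    have h3 : (fun z : ℂ => lcTail (N - k) (h * z)) =O[nhds 0]
        (fun z : ℂ => (‖(h : ℂ) * z‖ ^ (N - k) * Real.exp ‖(h : ℂ) * z‖ : ℝ)) :=
      Asymptotics.IsBigO.of_norm_le (fun z => lcTail_bound1 _ _)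
    refine h3.trans ?_
    have h4 : (fun z : ℂ => Real.exp ‖(h : ℂ) * z‖) =O[nhds 0] (fun _ => (1 : ℝ)) := by
      have : Continuous (fun z : ℂ => Real.exp ‖(h : ℂ) * z‖) := by fun_prop
      exact (this.tendsto 0).isBigO_one ℝ
    have h5 : (fun z : ℂ => ‖(h : ℂ) * z‖ ^ (N - k)) =O[nhds 0] (fun z => z ^ (N - k)) := by
      refine Asymptotics.IsBigO.of_bound (‖(h : ℂ)‖ ^ (N - k)) (Filter.Eventually.of_forall (fun z => ?_))
      rw [norm_mul, mul_pow, norm_mul, norm_pow, norm_pow, norm_pow, norm_norm, norm_norm]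
    have h6 := h5.norm_right.mul h4
    simp only [mul_one] at h6
    exact h6.of_norm_right
  have h7 : (fun z : ℂ => ((b h).coeff k : ℂ) * z ^ k) =O[nhds 0] (fun z => z ^ k) :=
    Asymptotics.isBigO_const_mul_self _ _ _
  have h8 := h7.mul h2
  have h9 : (fun z : ℂ => z ^ k * z ^ (N - k)) = fun z => z ^ N := by
    funext z; rw [← pow_add]; congr 1; omega
  rw [h9] at h8
  exact h8

theorem lc_zero_estimate (b : ℕ → Polynomial ℤ) (n m : ℕ) (hn : 1 ≤ n) (hb : ∀ h, (b h).natDegree ≤ m)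
    (hv : ∀ l < m + n * (m+1), lcC n m b l = 0) (hb0 : (b 0).coeff m ≠ 0) (z₀ γ : ℂ) (hγ : γ ≠ 1) :
    ∃ j ≤ m, lcF n (lcD^[j] b) z₀ γ ≠ 0 := by
  classical
  by_contra hcon
  push Not at hcon
  obtain ⟨H, hH0, hH⟩ : ∃ H : ℤ, 0 ≤ H ∧ ∀ h ∈ range (n+1), ∀ k, |(b h).coeff k| ≤ H := by
    refine ⟨∑ h ∈ range (n+1), ∑ k ∈ range (m+1), |(b h).coeff k|, by positivity, ?_⟩
    intro h hh k
    by_cases hk : k ≤ m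
    · refine le_trans ?_ (Finset.single_le_sum (f := fun h => ∑ k ∈ range (m+1), |(b h).coeff k|)
        (fun _ _ => by positivity) hh)
      exact Finset.single_le_sum (f := fun k => |(b h).coeff k|) (fun _ _ => by positivity)
        (mem_range.2 (by omega))
    · rw [Polynomial.coeff_eq_zero_of_natDegree_lt ((hb h).trans_lt (by omega)), abs_zero]
      positivity
  have hit := lcD_iter b n m hb H hH0 hH
  set A : Matrix (Fin (m+1)) (Fin (m+1)) (Polynomial ℂ) := Matrix.of (fun j k =>
    ∑ h ∈ range (n+1), Polynomial.C (((lcD^[(j : ℕ)] b h).coeff (m - k) : ℤ) : ℂ) * Polynomial.X ^ h) with hA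
  have hmul : ∀ (z x : ℂ) (j : Fin (m+1)), ∑ k : Fin (m+1), (A j k).eval x * z ^ (m - (k : ℕ)) =
      lcF n (lcD^[(j : ℕ)] b) z x := by
    intro z x j
    simp only [hA, Matrix.of_apply, Polynomial.eval_finsetSum, Polynomial.eval_mul, Polynomial.eval_C,
      Polynomial.eval_pow, Polynomial.eval_X, lcF]
    have h1 : ∀ h, Polynomial.aeval z (lcD^[(j : ℕ)] b h) =
        ∑ k : Fin (m+1), (((lcD^[(j : ℕ)] b h).coeff (m - k) : ℤ) : ℂ) * z ^ (m - (k : ℕ)) := by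
      intro h
      rw [Polynomial.aeval_eq_sum_range' (Nat.lt_succ_of_le ((hit j).1 h)),
        Fin.sum_univ_eq_sum_range (fun k => (((lcD^[(j : ℕ)] b h).coeff (m - k) : ℤ) : ℂ) * z ^ (m - k)) (m+1),
        ← Finset.sum_range_reflect]
      refine Finset.sum_congr rfl (fun k _ => ?_)
      simp [zsmul_eq_mul]
    simp only [h1, Finset.sum_mul]
    rw [Finset.sum_comm]
    refine Finset.sum_congr rfl (fun h _ => Finset.sum_congr rfl (fun k _ => by ring))
  have hdet0 : A.det.eval 0 ≠ 0 := by
    have h1 : A.det.eval 0 = (A.map (Polynomial.evalRingHom (0 : ℂ))).det := by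
      rw [← Polynomial.coe_evalRingHom, RingHom.map_det]; rfl
    have hent : ∀ j k : Fin (m+1), (A.map (Polynomial.evalRingHom (0 : ℂ))) j k =
        (((Polynomial.derivative^[(j : ℕ)] (b 0)).coeff (m - k) : ℤ) : ℂ) := by
      intro j k
      simp only [hA, Matrix.map_apply, Matrix.of_apply, Polynomial.coe_evalRingHom, Polynomial.eval_finsetSum,
        Polynomial.eval_mul, Polynomial.eval_C, Polynomial.eval_pow, Polynomial.eval_X]
      rw [Finset.sum_eq_single_of_mem 0 (by simp)]
      · rw [(hit j).2.2.2]; simp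
      · intro h _ hh
        rw [zero_pow hh, mul_zero]
    rw [h1, Matrix.det_of_isUpperTriangular]
    · rw [Finset.prod_ne_zero_iff]
      intro j _
      rw [hent, Polynomial.coeff_iterate_derivative]
      have h2 : m - (j : ℕ) + j = m := by omega
      rw [h2]
      have h3 : m.descFactorial j ≠ 0 := by
        rw [Ne, Nat.descFactorial_eq_zero_iff_lt]; omega
      simp [h3, hb0]
    · intro j k hkj
      have hkj' : (k : ℕ) < j := hkj
      rw [hent, Polynomial.coeff_iterate_derivative,
        Polynomial.coeff_eq_zero_of_natDegree_lt ((hb 0).trans_lt (by omega))]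
      simp
  have hdetne : A.det ≠ 0 := by
    intro h; rw [h] at hdet0; simp at hdet0
  have hdeg : A.det.natDegree ≤ n * (m+1) := by
    rw [Matrix.det_apply]
    refine Polynomial.natDegree_sum_le_of_forall_le _ _ (fun σ _ => ?_)
    refine (Polynomial.natDegree_smul_le _ _).trans ?_
    refine (Polynomial.natDegree_prod_le _ _).trans ?_
    calc _ ≤ ∑ i : Fin (m+1), n := by
          refine Finset.sum_le_sum (fun i _ => ?_)
          simp only [hA, Matrix.of_apply]
          refine Polynomial.natDegree_sum_le_of_forall_le _ _ (fun h hh => ?_)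
          refine (Polynomial.natDegree_C_mul_X_pow_le _ _).trans ?_
          simpa [Nat.lt_succ_iff] using hh
      _ = n * (m+1) := by simp [mul_comm]
  have hbig : (fun z : ℂ => A.det.eval (Complex.exp z)) =O[nhds 0] (fun z => z ^ (n * (m+1))) := by
    have h1 : (fun z : ℂ => A.det.eval (Complex.exp z)) = fun z =>
        ∑ j : Fin (m+1), (A.adjugate (Fin.last m) j).eval (Complex.exp z) *
          lcF n (lcD^[(j : ℕ)] b) z (Complex.exp z) := by
      funext z
      have h2 : ∀ k, ∑ j, A.adjugate (Fin.last m) j * A j k = if Fin.last m = k then A.det else 0 := by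
        intro k
        have := congrFun (congrFun A.adjugate_mul (Fin.last m)) k
        rw [Matrix.mul_apply] at this
        rw [this, Matrix.smul_apply, Matrix.one_apply]
        simp
      simp only [← hmul, Finset.mul_sum]
      rw [Finset.sum_comm]
      have h3 : ∀ k : Fin (m+1), ∑ j, (A.adjugate (Fin.last m) j).eval (Complex.exp z) *
          ((A j k).eval (Complex.exp z) * z ^ (m - (k : ℕ))) =
          if Fin.last m = k then A.det.eval (Complex.exp z) else 0 := by
        intro k
        have h4 := congrArg (Polynomial.eval (Complex.exp z)) (h2 k)
        rw [Polynomial.eval_finsetSum] at h4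
        simp only [← mul_assoc, ← Finset.sum_mul]
        simp only [Polynomial.eval_mul] at h4
        rw [h4]
        split_ifs with h5
        · rw [← h5]; simp
        · simp
      rw [Finset.sum_congr rfl (fun k _ => h3 k)]
      simp
    rw [h1]
    refine Asymptotics.IsBigO.fun_sum (fun j _ => ?_)
    have h2 : (fun z : ℂ => (A.adjugate (Fin.last m) j).eval (Complex.exp z)) =O[nhds 0] (fun _ => (1 : ℂ)) := by
      have : Continuous (fun z : ℂ => (A.adjugate (Fin.last m) j).eval (Complex.exp z)) :=
        (Polynomial.continuous _).comp Complex.continuous_exp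
      exact (this.tendsto 0).isBigO_one ℂ
    have h3 := lcF_isBigO (lcD^[(j : ℕ)] b) n m (n * (m+1)) (hit j).1 (by nlinarith) (fun l hl => by
      rw [(hit j).2.2.1]
      apply hv
      omega)
    simpa only [one_mul] using h2.mul h3
  have hdvd1 := lc_dvd_of_isBigO A.det hdetne _ hbig
  have hroot : A.det.eval γ = 0 := by
    have h1 : A.det.eval γ = (A.map (Polynomial.evalRingHom γ)).det := by
      rw [← Polynomial.coe_evalRingHom, RingHom.map_det]; rfl
    rw [h1]
    rw [← Matrix.exists_mulVec_eq_zero_iff]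
    refine ⟨fun k => z₀ ^ (m - (k : ℕ)), ?_, ?_⟩
    · intro h
      have := congrFun h (Fin.last m)
      simp at this
    · funext j
      have := hmul z₀ γ j
      rw [hcon j (by omega)] at this
      simpa [Matrix.mulVec, dotProduct] using this
  have hdvd2 : (Polynomial.X - Polynomial.C γ) ∣ A.det := Polynomial.dvd_iff_isRoot.2 hroot
  have hcop : IsCoprime ((Polynomial.X - Polynomial.C (1 : ℂ)) ^ (n * (m+1))) (Polynomial.X - Polynomial.C γ) := by
    refine IsCoprime.pow_left ?_
    exact Polynomial.isCoprime_X_sub_C_of_isUnit_sub (sub_ne_zero.2 hγ.symm).isUnit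
  have h1 := Polynomial.natDegree_le_of_dvd (hcop.mul_dvd hdvd1 hdvd2) hdetne
  rw [Polynomial.Monic.natDegree_mul ((Polynomial.monic_X_sub_C _).pow _) (Polynomial.monic_X_sub_C _),
    Polynomial.natDegree_pow, Polynomial.natDegree_X_sub_C, Polynomial.natDegree_X_sub_C] at h1
  omega


theorem lc_liouville_ineq (γ : ℂ) (hγ : IsAlgebraic ℚ γ) :
    ∃ (D : ℕ) (Λ : ℝ), 1 ≤ Λ ∧ ∀ (n m : ℕ) (b : ℕ → Polynomial ℤ) (H : ℤ),
      (∀ h, (b h).natDegree ≤ m) → (∀ h ∈ range (n+1), ∀ k, |(b h).coeff k| ≤ H) →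
      ∀ (p : ℤ) (q P : ℕ), 1 ≤ q → q ≤ P → |p| ≤ P →
      lcF n b (Complex.I * (p / q : ℂ)) γ ≠ 0 →
      1 ≤ (Λ ^ n * P ^ m * ‖lcF n b (Complex.I * (p / q : ℂ)) γ‖) *
        ((n+1) * (m+1) * H * P ^ m * Λ ^ (n + m)) ^ D := by
  classical
  let K := IntermediateField.adjoin ℚ ({Complex.I, γ} : Set ℂ)
  have hIint : IsIntegral ℤ Complex.I := by
    refine ⟨Polynomial.X ^ 2 + Polynomial.C 1, Polynomial.monic_X_pow_add_C _ (by norm_num), ?_⟩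
    simp
  have hfd : FiniteDimensional ℚ K := by
    apply IntermediateField.finiteDimensional_adjoin
    intro x hx
    rcases hx with rfl | hx
    · exact hIint.tower_top
    · rw [Set.mem_singleton_iff] at hx
      rw [hx]; exact hγ.isIntegral
  let iK : K := ⟨Complex.I, IntermediateField.subset_adjoin _ _ (by simp)⟩
  let gK : K := ⟨γ, IntermediateField.subset_adjoin _ _ (by simp)⟩
  have hγZ : IsAlgebraic ℤ γ := (IsFractionRing.isAlgebraic_iff ℤ ℚ ℂ).2 hγ
  obtain ⟨c, hc0, hc⟩ := hγZ.exists_integral_multiple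
  have hinj : Function.Injective (algebraMap K ℂ) := (algebraMap K ℂ).injective
  have hiK : IsIntegral ℤ iK := by
    rw [← isIntegral_algebraMap_iff (B := ℂ) hinj]; exact hIint
  have hgK : IsIntegral ℤ ((c : K) * gK) := by
    rw [← isIntegral_algebraMap_iff (B := ℂ) hinj]
    have : algebraMap K ℂ ((c : K) * gK) = c • γ := by
      rw [map_mul, map_intCast, zsmul_eq_mul]; rfl
    rw [this]; exact hc
  set G : ℝ := 1 + ∑ σ : K →ₐ[ℚ] ℂ, (‖σ iK‖ + ‖σ gK‖) with hG
  have hG1 : 1 ≤ G := by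
    rw [hG]; have : 0 ≤ ∑ σ : K →ₐ[ℚ] ℂ, (‖σ iK‖ + ‖σ gK‖) := Finset.sum_nonneg (fun _ _ => by positivity)
    linarith
  have hGσ : ∀ σ : K →ₐ[ℚ] ℂ, ‖σ iK‖ ≤ G ∧ ‖σ gK‖ ≤ G := by
    intro σ
    have h1 := Finset.single_le_sum (f := fun σ : K →ₐ[ℚ] ℂ => (‖σ iK‖ + ‖σ gK‖))
      (fun _ _ => by positivity) (mem_univ σ)
    have h2 := norm_nonneg (σ iK)
    have h3 := norm_nonneg (σ gK)
    constructor <;> linarith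
  have hc1 : (1 : ℝ) ≤ |(c : ℝ)| := by
    exact_mod_cast Int.one_le_abs hc0
  set Λ : ℝ := |(c : ℝ)| * G with hΛ
  have hΛ1 : 1 ≤ Λ := one_le_mul_of_one_le_of_one_le hc1 hG1
  have hGΛ : G ≤ Λ := le_mul_of_one_le_left (by linarith) hc1
  have hcΛ : |(c : ℝ)| ≤ Λ := le_mul_of_one_le_right (by linarith) hG1
  refine ⟨Fintype.card (K →ₐ[ℚ] ℂ) - 1, Λ, hΛ1, ?_⟩
  intro n m b H hb hbH p q P hq hqP hpP hne
  have hH0 : 0 ≤ H := (abs_nonneg _).trans (hbH 0 (by simp) 0)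
  have hq0 : (q : ℂ) ≠ 0 := by exact_mod_cast (by omega : q ≠ 0)
  set x : K := ∑ h ∈ range (n+1), ∑ k ∈ range (m+1),
    ((b h).coeff k : K) * iK ^ k * (p : K) ^ k * (q : K) ^ (m - k) * (c : K) ^ (n - h) * ((c : K) * gK) ^ h with hx
  have hxint : IsIntegral ℤ x := by
    refine IsIntegral.sum _ (fun h _ => IsIntegral.sum _ (fun k _ => ?_))
    have hZ : ∀ a : ℤ, IsIntegral ℤ (a : K) := fun a => by
      simpa using (isIntegral_algebraMap (R := ℤ) (A := K) (x := a))
    have hN : IsIntegral ℤ (q : K) := by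
      simpa using hZ q
    exact (((((hZ _).mul (hiK.pow _)).mul ((hZ _).pow _)).mul (hN.pow _)).mul ((hZ _).pow _)).mul (hgK.pow _)
  have hxσ : ∀ σ : K →ₐ[ℚ] ℂ, σ x = ∑ h ∈ range (n+1), ∑ k ∈ range (m+1),
      ((b h).coeff k : ℂ) * (σ iK) ^ k * (p : ℂ) ^ k * (q : ℂ) ^ (m - k) * (c : ℂ) ^ (n - h) * ((c : ℂ) * σ gK) ^ h := by
    intro σ
    simp only [hx, map_sum, map_mul, map_pow, map_intCast, map_natCast]
  obtain ⟨σ0, e1, e2⟩ : ∃ σ0 : K →ₐ[ℚ] ℂ, σ0 iK = Complex.I ∧ σ0 gK = γ := ⟨K.val, rfl, rfl⟩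
  have hσ0 : σ0 x = (c : ℂ) ^ n * (q : ℂ) ^ m * lcF n b (Complex.I * (p / q : ℂ)) γ := by
    rw [hxσ, lcF, Finset.mul_sum]
    refine Finset.sum_congr rfl (fun h hh => ?_)
    rw [Polynomial.aeval_eq_sum_range' (Nat.lt_succ_of_le (hb h)), Finset.sum_mul, Finset.mul_sum]
    refine Finset.sum_congr rfl (fun k hk => ?_)
    rw [e1, e2, zsmul_eq_mul]
    have e3 : (c : ℂ) ^ n = c ^ (n - h) * c ^ h := by
      rw [← pow_add]; congr 1; have := mem_range.1 hh; omega
    have e4 : (q : ℂ) ^ m = q ^ (m - k) * q ^ k := by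
      rw [← pow_add]; congr 1; have := mem_range.1 hk; omega
    rw [e3, e4, mul_pow, mul_pow, div_pow]
    field_simp
  have hP1 : (1 : ℝ) ≤ P := by exact_mod_cast hq.trans hqP
  have hbound : ∀ σ : K →ₐ[ℚ] ℂ, ‖σ x‖ ≤ (n+1) * (m+1) * H * P ^ m * Λ ^ (n + m) := by
    intro σ
    rw [hxσ]
    have hterm : ∀ h ∈ range (n+1), ∀ k ∈ range (m+1), ‖((b h).coeff k : ℂ) * (σ iK) ^ k * (p : ℂ) ^ k * (q : ℂ) ^ (m - k) * (c : ℂ) ^ (n - h) * ((c : ℂ) * σ gK) ^ h‖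
        ≤ H * P ^ m * Λ ^ (n + m) := by
      intro h hh k hk
      have hh' : h ≤ n := by simpa [Nat.lt_succ_iff] using hh
      have hk' : k ≤ m := by simpa [Nat.lt_succ_iff] using hk
      have t1 : ‖((b h).coeff k : ℂ)‖ ≤ H := by
        rw [Complex.norm_intCast]; exact_mod_cast hbH h hh k
      have t2 : ‖(p : ℂ)‖ ≤ P := by
        rw [Complex.norm_intCast]; exact_mod_cast hpP
      have t3 : ‖(q : ℂ)‖ ≤ P := by
        rw [Complex.norm_natCast]; exact_mod_cast hqP
      have t4 : ‖(c : ℂ)‖ ≤ Λ := by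
        rw [Complex.norm_intCast]; exact hcΛ
      have t5 : ‖(c : ℂ) * σ gK‖ ≤ Λ := by
        rw [norm_mul, Complex.norm_intCast, hΛ]
        gcongr
        exact (hGσ σ).2
      have t6 : ‖σ iK‖ ≤ Λ := (hGσ σ).1.trans hGΛ
      have hH0' : (0 : ℝ) ≤ H := by exact_mod_cast hH0
      rw [norm_mul, norm_mul, norm_mul, norm_mul, norm_mul, norm_pow, norm_pow, norm_pow, norm_pow, norm_pow]
      calc _ ≤ (H : ℝ) * Λ ^ k * P ^ k * P ^ (m - k) * Λ ^ (n - h) * Λ ^ h := by gcongr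
        _ = H * P ^ (k + (m - k)) * Λ ^ (k + (n - h) + h) := by rw [pow_add, pow_add, pow_add]; ring
        _ ≤ H * P ^ m * Λ ^ (n + m) := by
          rw [show k + (m - k) = m by omega]
          exact mul_le_mul_of_nonneg_left (pow_le_pow_right₀ hΛ1 (by omega)) (by positivity)
    refine (norm_sum_le_of_le _ (fun h hh => norm_sum_le_of_le _ (hterm h hh))).trans ?_
    simp only [sum_const, card_range, nsmul_eq_mul]
    push_cast
    apply le_of_eq; ring
  have hx0 : x ≠ 0 := by
    intro h
    rw [h, map_zero] at hσ0
    have hcC : (c : ℂ) ≠ 0 := by exact_mod_cast hc0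
    exact (mul_ne_zero (mul_ne_zero (pow_ne_zero _ hcC) (pow_ne_zero _ hq0)) hne) hσ0.symm
  have hnorm := Algebra.norm_eq_prod_embeddings ℚ ℂ x
  obtain ⟨y, hy⟩ := IsIntegrallyClosed.isIntegral_iff.1 (Algebra.isIntegral_norm ℚ hxint)
  have hy0 : y ≠ 0 := by
    rintro rfl
    rw [map_zero] at hy
    exact hx0 (Algebra.norm_eq_zero_iff.1 hy.symm)
  have h1 : (1 : ℝ) ≤ ∏ σ : K →ₐ[ℚ] ℂ, ‖σ x‖ := by
    rw [← norm_prod, ← hnorm, ← hy]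
    simp only [eq_intCast, map_intCast, Complex.norm_intCast]
    exact_mod_cast Int.one_le_abs hy0
  rw [← Finset.mul_prod_erase univ (fun σ : K →ₐ[ℚ] ℂ => ‖σ x‖) (mem_univ σ0)] at h1
  refine h1.trans ?_
  have h2 : ∏ σ ∈ univ.erase σ0, ‖σ x‖ ≤ ((n+1) * (m+1) * H * P ^ m * Λ ^ (n + m)) ^ (Fintype.card (K →ₐ[ℚ] ℂ) - 1) := by
    refine (Finset.prod_le_prod (fun σ _ => norm_nonneg _) (fun σ _ => hbound σ)).trans ?_
    rw [Finset.prod_const, card_erase_of_mem (mem_univ _), Finset.card_univ]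
  have h3 : ‖σ0 x‖ ≤ Λ ^ n * P ^ m * ‖lcF n b (Complex.I * (p / q : ℂ)) γ‖ := by
    rw [hσ0, norm_mul, norm_mul, norm_pow, norm_pow, Complex.norm_intCast, Complex.norm_natCast]
    gcongr
  exact mul_le_mul h3 h2 (Finset.prod_nonneg (fun _ _ => norm_nonneg _)) (by positivity)


theorem lc_lcm_bound : ∃ C : ℝ, 1 ≤ C ∧ ∀ n : ℕ, ∃ d : ℕ, 0 < d ∧ (∀ j, 1 ≤ j → j ≤ n → j ∣ d) ∧
    (d : ℝ) ≤ C ^ n := by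
  refine ⟨Real.exp (Real.log 4 + 4), Real.one_le_exp (by have := Real.log_nonneg (show (1:ℝ) ≤ 4 by norm_num); linarith), ?_⟩
  intro n
  refine ⟨Nat.lcmUpto n, Nat.lcmUpto_pos n, ?_, ?_⟩
  · intro j h1 h2
    exact Finset.dvd_lcm (f := id) (Finset.mem_Icc.2 ⟨h1, h2⟩)
  · have h0 : (0 : ℝ) < Nat.lcmUpto n := by exact_mod_cast Nat.lcmUpto_pos n
    rw [← Real.exp_nat_mul, ← Real.log_le_iff_le_exp h0]
    have h1 := Chebyshev.psi_le_const_mul_self (x := (n : ℝ)) (by positivity)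
    have h2 := Chebyshev.psi_eq_log_lcmUpto n
    rw [← h2]
    linarith

theorem lcF_upper (b : ℕ → Polynomial ℤ) (n m N : ℕ) (H : ℤ) (hb : ∀ h, (b h).natDegree ≤ m)
    (hbH : ∀ h ∈ range (n+1), ∀ k, |(b h).coeff k| ≤ H) (hmN : m ≤ N)
    (hv : ∀ l < N, lcC n m b l = 0) (z : ℂ) (A t : ℝ) (hA : 1 ≤ A) (hz : ‖z‖ ≤ A) (ht : 1 ≤ t) :
    ‖lcF n b z (Complex.exp z)‖ ≤ ((n+1) * (m+1) * H * A ^ m) * (Real.exp (t * (n * A)) / t ^ (N - m)) := by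
  rw [lcF_eq_tail b n m N hb hmN hv z]
  have hH0 : 0 ≤ H := (abs_nonneg _).trans (hbH 0 (by simp) 0)
  have hH0' : (0 : ℝ) ≤ H := by exact_mod_cast hH0
  have hterm : ∀ h ∈ range (n+1), ∀ k ∈ range (m+1),
      ‖((b h).coeff k : ℂ) * z ^ k * lcTail (N - k) (h * z)‖ ≤ H * A ^ m * (Real.exp (t * (n * A)) / t ^ (N - m)) := by
    intro h hh k hk
    have hh' : h ≤ n := by simpa [Nat.lt_succ_iff] using hh
    have hk' : k ≤ m := by simpa [Nat.lt_succ_iff] using hk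
    have t1 : ‖((b h).coeff k : ℂ)‖ ≤ H := by
      rw [Complex.norm_intCast]; exact_mod_cast hbH h hh k
    have t2 : ‖z‖ ^ k ≤ A ^ m :=
      (pow_le_pow_left₀ (norm_nonneg _) hz k).trans (pow_le_pow_right₀ hA hk')
    have t3 : ‖lcTail (N - k) (h * z)‖ ≤ Real.exp (t * (n * A)) / t ^ (N - m) := by
      refine (lcTail_bound2 _ _ t ht).trans ?_
      have hhz : ‖(h : ℂ) * z‖ ≤ n * A := by
        rw [norm_mul, Complex.norm_natCast]
        have : (h : ℝ) ≤ n := by exact_mod_cast hh'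
        gcongr
      have e2 : t ^ (N - m) ≤ t ^ (N - k) := pow_le_pow_right₀ ht (by omega)
      have : 0 < t := by linarith
      have e1 : Real.exp (t * ‖(h : ℂ) * z‖) ≤ Real.exp (t * (n * A)) := by
        apply Real.exp_le_exp.2; gcongr
      exact div_le_div₀ (by positivity) e1 (by positivity) e2
    rw [norm_mul, norm_mul, norm_pow]
    gcongr
  refine (norm_sum_le_of_le _ (fun h hh => norm_sum_le_of_le _ (hterm h hh))).trans ?_
  simp only [sum_const, card_range, nsmul_eq_mul]
  push_cast
  apply le_of_eq; ring

theorem lc_pow_sub (z w : ℂ) (A : ℝ) (hA : 1 ≤ A) (hz : ‖z‖ ≤ A) (hw : ‖w‖ ≤ A) (k m : ℕ) (hk : k ≤ m) :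
    ‖z ^ k - w ^ k‖ ≤ m * A ^ m * ‖z - w‖ := by
  have h := (Commute.all z w).mul_geom_sum₂ k
  rw [← h, norm_mul, mul_comm]
  gcongr
  have : ∀ i ∈ range k, ‖z ^ i * w ^ (k - 1 - i)‖ ≤ A ^ m := by
    intro i hi
    have hi' := mem_range.1 hi
    rw [norm_mul, norm_pow, norm_pow]
    calc ‖z‖ ^ i * ‖w‖ ^ (k - 1 - i) ≤ A ^ i * A ^ (k - 1 - i) := by gcongr
      _ = A ^ (i + (k - 1 - i)) := by rw [pow_add]
      _ ≤ A ^ m := pow_le_pow_right₀ hA (by omega)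
  refine (norm_sum_le_of_le _ this).trans ?_
  simp only [sum_const, card_range, nsmul_eq_mul]
  have : (k : ℝ) ≤ m := by exact_mod_cast hk
  gcongr

theorem lcF_diff (b : ℕ → Polynomial ℤ) (n m : ℕ) (H : ℤ) (hb : ∀ h, (b h).natDegree ≤ m)
    (hbH : ∀ h ∈ range (n+1), ∀ k, |(b h).coeff k| ≤ H) (z w γ : ℂ) (A : ℝ) (hA : 1 ≤ A)
    (hz : ‖z‖ ≤ A) (hw : ‖w‖ ≤ A) (hγ : ‖γ‖ = 1) :
    ‖lcF n b z γ - lcF n b w γ‖ ≤ ((n+1) * (m+1) * H * A ^ m) * (m * ‖z - w‖) := by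
  have hH0 : 0 ≤ H := (abs_nonneg _).trans (hbH 0 (by simp) 0)
  have hH0' : (0 : ℝ) ≤ H := by exact_mod_cast hH0
  have e : lcF n b z γ - lcF n b w γ = ∑ h ∈ range (n+1), ∑ k ∈ range (m+1),
      ((b h).coeff k : ℂ) * (z ^ k - w ^ k) * γ ^ h := by
    rw [lcF, lcF, ← Finset.sum_sub_distrib]
    refine Finset.sum_congr rfl (fun h _ => ?_)
    rw [Polynomial.aeval_eq_sum_range' (Nat.lt_succ_of_le (hb h)),
      Polynomial.aeval_eq_sum_range' (Nat.lt_succ_of_le (hb h)), ← sub_mul, ← Finset.sum_sub_distrib, Finset.sum_mul]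
    refine Finset.sum_congr rfl (fun k _ => ?_)
    rw [zsmul_eq_mul, zsmul_eq_mul]; ring
  rw [e]
  have hterm : ∀ h ∈ range (n+1), ∀ k ∈ range (m+1),
      ‖((b h).coeff k : ℂ) * (z ^ k - w ^ k) * γ ^ h‖ ≤ H * (m * A ^ m * ‖z - w‖) := by
    intro h hh k hk
    have hk' : k ≤ m := by simpa [Nat.lt_succ_iff] using hk
    have t1 : ‖((b h).coeff k : ℂ)‖ ≤ H := by
      rw [Complex.norm_intCast]; exact_mod_cast hbH h hh k
    rw [norm_mul, norm_mul, norm_pow, hγ, one_pow, mul_one]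
    exact mul_le_mul t1 (lc_pow_sub z w A hA hz hw k m hk') (norm_nonneg _) hH0'
  refine (norm_sum_le_of_le _ (fun h hh => norm_sum_le_of_le _ (hterm h hh))).trans ?_
  simp only [sum_const, card_range, nsmul_eq_mul]
  push_cast
  apply le_of_eq; ring

theorem lc_size (n m : ℕ) (hm : 1 ≤ m) (hmn : m ≤ n) (d C A Λ : ℝ) (hd0 : 0 ≤ d) (hC : 1 ≤ C) (hA : 1 ≤ A) (hΛ : 1 ≤ Λ)
    (hd : d ≤ C ^ n) :
    ((n:ℝ)+1) * (m+1) * (((n:ℝ) + m) ^ m * ((2 ^ n) ^ (m+1) * m.factorial * d ^ m * ((n:ℝ) * (m+1)) ^ m)) * A ^ m * Λ ^ (n + m)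
      ≤ (16 * 4 * 4 * 2 * 8 * C * A * Λ ^ 2) ^ (m * n) := by
  have hn : 1 ≤ n := hm.trans hmn
  have hmn' : (m : ℝ) ≤ n := by exact_mod_cast hmn
  have hn' : (1 : ℝ) ≤ n := by exact_mod_cast hn
  have hm' : (1 : ℝ) ≤ m := by exact_mod_cast hm
  have h2n : (n : ℝ) ≤ 2 ^ n := by exact_mod_cast (Nat.lt_two_pow_self (n := n)).le
  have h22 : (2:ℝ) ≤ 2 ^ n := by
    calc (2:ℝ) = 2 ^ 1 := by norm_num
      _ ≤ 2 ^ n := pow_le_pow_right₀ (by norm_num) hn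
  have hnm : n ≤ m * n := Nat.le_mul_of_pos_left n hm
  have hmm : m ≤ m * n := Nat.le_mul_of_pos_right m hn
  have a4 : (4:ℝ) ^ n = 2 ^ n * 2 ^ n := by rw [← mul_pow]; norm_num
  have a8 : (8:ℝ) ^ n = 2 ^ n * (2 ^ n * 2 ^ n) := by rw [← mul_pow, ← mul_pow]; norm_num
  have a16 : (16:ℝ) ^ n = (2 ^ n * 2 ^ n) * (2 ^ n * 2 ^ n) := by
    rw [← mul_pow, ← mul_pow]; norm_num
  have p1 : ((n:ℝ)+1) * (m+1) ≤ 16 ^ (m * n) := by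
    refine le_trans ?_ (pow_le_pow_right₀ (by norm_num) hnm)
    rw [a16]
    have : (n:ℝ) + 1 ≤ 2 ^ n * 2 ^ n := by nlinarith
    have : (m:ℝ) + 1 ≤ 2 ^ n * 2 ^ n := by nlinarith
    gcongr
  have p2 : ((n:ℝ) + m) ^ m ≤ 4 ^ (m * n) := by
    rw [mul_comm m n, pow_mul]
    gcongr
    rw [a4]; nlinarith
  have p3 : ((2:ℝ) ^ n) ^ (m+1) ≤ 4 ^ (m * n) := by
    rw [← pow_mul, show (4:ℝ) = 2 ^ 2 by norm_num, ← pow_mul]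
    exact pow_le_pow_right₀ (by norm_num) (by nlinarith)
  have p4 : (m.factorial : ℝ) ≤ 2 ^ (m * n) := by
    have : (m.factorial : ℝ) ≤ (m:ℝ) ^ m := by exact_mod_cast Nat.factorial_le_pow m
    refine this.trans ?_
    rw [mul_comm m n, pow_mul]
    gcongr
    linarith
  have p5 : d ^ m ≤ C ^ (m * n) := by
    rw [mul_comm m n, pow_mul]; gcongr
  have p6 : ((n:ℝ) * (m+1)) ^ m ≤ 8 ^ (m * n) := by
    rw [mul_comm m n, pow_mul]
    gcongr
    rw [a8]
    have : (m:ℝ) + 1 ≤ 2 ^ n * 2 ^ n := by nlinarith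
    gcongr
  have p7 : A ^ m ≤ A ^ (m * n) := pow_le_pow_right₀ hA hmm
  have p8 : Λ ^ (n + m) ≤ (Λ ^ 2) ^ (m * n) := by
    rw [← pow_mul]; exact pow_le_pow_right₀ hΛ (by omega)
  calc _ ≤ (16:ℝ) ^ (m * n) * (4 ^ (m * n) * (4 ^ (m * n) * 2 ^ (m * n) * C ^ (m * n) * 8 ^ (m * n))) * A ^ (m * n) * (Λ ^ 2) ^ (m * n) := by
        gcongr
    _ = _ := by simp only [mul_pow]; ring


theorem lc_step (α : ℝ) (hγ : IsAlgebraic ℚ (Complex.exp (Complex.I * α)))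
    (hγ1 : Complex.exp (Complex.I * α) ≠ 1) :
    ∃ (D A : ℕ) (κ : ℝ), 1 ≤ A ∧ 1 ≤ κ ∧ ∀ n m : ℕ, 1 ≤ m → m ≤ n → ∀ (p : ℤ) (q : ℕ), 1 ≤ q →
      |α - p / q| ≤ 1 →
      1 ≤ (((A * q : ℕ) : ℝ) ^ m * κ ^ (m * n)) ^ (D + 1) *
        ((Real.exp A / m) ^ (m * n) + m * |α - p / q|) := by
  obtain ⟨D, Λ, hΛ, hineq⟩ := lc_liouville_ineq _ hγ
  obtain ⟨C, hC, hd⟩ := lc_lcm_bound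
  obtain ⟨A, hA⟩ := exists_nat_ge (|α| + 1)
  have hA1 : (1 : ℝ) ≤ A := by have := abs_nonneg α; linarith
  have hA1' : 1 ≤ A := by exact_mod_cast hA1
  refine ⟨D, A, 16 * 4 * 4 * 2 * 8 * C * A * Λ ^ 2, hA1', ?_, ?_⟩
  · have : 1 ≤ Λ ^ 2 := one_le_pow₀ hΛ
    have h2 : 1 ≤ C * A * Λ ^ 2 :=
      one_le_mul_of_one_le_of_one_le (one_le_mul_of_one_le_of_one_le hC hA1) this
    nlinarith
  intro n m hm hmn p q hq hε
  have hn : 1 ≤ n := hm.trans hmn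
  obtain ⟨d, hd0, hdiv, hdC⟩ := hd n
  obtain ⟨b, hb, hbH, hb0, hv⟩ := lc_exists_b n m d hn hd0 hdiv
  set H0 : ℤ := (2 ^ n) ^ (m+1) * m.factorial * d ^ m * ((n * (m+1) : ℕ) : ℤ) ^ m with hH0
  have hH0n : 0 ≤ H0 := by positivity
  set γ := Complex.exp (Complex.I * α) with hγdef
  obtain ⟨j, hj, hne⟩ := lc_zero_estimate b n m hn hb hv hb0 (Complex.I * (p / q : ℂ)) γ hγ1
  obtain ⟨i1, i2, i3, -⟩ := lcD_iter b n m hb H0 hH0n hbH j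
  set b' := lcD^[j] b with hb'
  set H : ℤ := ((n + m : ℕ) : ℤ) ^ m * H0 with hH
  have hHn : 0 ≤ H := by positivity
  have i2' : ∀ h ∈ range (n+1), ∀ k, |(b' h).coeff k| ≤ H := by
    intro h hh k
    refine (i2 h hh k).trans ?_
    rw [hH]
    have : (1 : ℤ) ≤ ((n + m : ℕ) : ℤ) := by exact_mod_cast (by omega : 1 ≤ n + m)
    exact mul_le_mul_of_nonneg_right (pow_le_pow_right₀ this hj) hH0n
  have hq' : (0 : ℝ) < q := by exact_mod_cast hq
  have hpq : |(p : ℝ) / q| ≤ A := by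
    have := abs_sub_abs_le_abs_sub ((p : ℝ) / q) α
    rw [abs_sub_comm] at this
    linarith
  have hpP : |p| ≤ ((A * q : ℕ) : ℤ) := by
    rw [abs_div, Nat.abs_cast, div_le_iff₀ hq'] at hpq
    exact_mod_cast hpq
  have key := hineq n m b' H i1 i2' p q (A * q) hq (Nat.le_mul_of_pos_left q hA1') hpP hne
  have hz : ‖Complex.I * (α : ℂ)‖ ≤ A := by
    rw [norm_mul, Complex.norm_I, one_mul, Complex.norm_real, Real.norm_eq_abs]; linarith
  have hw : ‖Complex.I * ((p : ℂ) / q)‖ ≤ A := by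
    rw [norm_mul, Complex.norm_I, one_mul]
    have : ((p : ℂ) / q) = (((p : ℝ) / q : ℝ) : ℂ) := by push_cast; rfl
    rw [this, Complex.norm_real, Real.norm_eq_abs]; exact hpq
  have hγn : ‖γ‖ = 1 := by
    rw [hγdef, mul_comm]; exact Complex.norm_exp_ofReal_mul_I α
  have hm' : (1 : ℝ) ≤ m := by exact_mod_cast hm
  have hzw : ‖Complex.I * ((p : ℂ) / q) - Complex.I * (α : ℂ)‖ = |α - p / q| := by
    rw [← mul_sub, norm_mul, Complex.norm_I, one_mul]
    have : ((p : ℂ) / q) - α = (((p : ℝ) / q - α : ℝ) : ℂ) := by push_cast; rfl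
    rw [this, Complex.norm_real, Real.norm_eq_abs, abs_sub_comm]
  have hNm : m ≤ n * (m + 1) := by nlinarith
  have U1 := lcF_upper b' n m (n * (m+1)) H i1 i2' hNm (fun l hl => by
    rw [i3]; exact hv _ (by omega)) (Complex.I * α) A m hA1 hz hm'
  have U2 := lcF_diff b' n m H i1 i2' (Complex.I * ((p : ℂ) / q)) (Complex.I * α) γ A hA1 hw hz hγn
  rw [hzw] at U2
  set S : ℝ := (n+1) * (m+1) * H * A ^ m with hS
  have hHR : (0 : ℝ) ≤ H := by exact_mod_cast hHn
  have hS0 : 0 ≤ S := by positivity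
  set ε := |α - p / q| with hεdef
  have hε0 : 0 ≤ ε := abs_nonneg _
  have U3 : Real.exp (m * (n * (A : ℝ))) / (m : ℝ) ^ (n * (m + 1) - m) ≤ (Real.exp A / m) ^ (m * n) := by
    rw [div_pow, ← Real.exp_nat_mul]
    have e1 : (m : ℝ) * (n * (A : ℝ)) = ((m * n : ℕ) : ℝ) * A := by push_cast; ring
    rw [e1]
    have e2 : (m : ℝ) ^ (m * n) ≤ (m : ℝ) ^ (n * (m + 1) - m) := by
      apply pow_le_pow_right₀ hm'
      have : n * (m + 1) = m * n + n := by ring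
      omega
    have : (0 : ℝ) < m := by linarith
    exact div_le_div_of_nonneg_left (by positivity) (by positivity) e2
  set δ := (Real.exp A / m) ^ (m * n) + m * ε with hδ
  have hF : ‖lcF n b' (Complex.I * ((p : ℂ) / q)) γ‖ ≤ S * δ := by
    have t1 := norm_add_le (lcF n b' (Complex.I * ((p : ℂ) / q)) γ - lcF n b' (Complex.I * α) γ)
      (lcF n b' (Complex.I * α) γ)
    rw [sub_add_cancel] at t1
    have t2 := mul_le_mul_of_nonneg_left U3 hS0
    rw [hδ, mul_add]
    linarith
  have hsize := lc_size n m hm hmn d C A Λ (by positivity) hC hA1 hΛ hdC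
  set κ := 16 * 4 * 4 * 2 * 8 * C * A * Λ ^ 2 with hκ
  have hHe : (H : ℝ) = ((n:ℝ) + m) ^ m * ((2 ^ n) ^ (m+1) * m.factorial * (d : ℝ) ^ m * ((n:ℝ) * (m+1)) ^ m) := by
    rw [hH, hH0]; push_cast; ring
  rw [← hHe] at hsize
  have hW : S * Λ ^ (n + m) ≤ κ ^ (m * n) := hsize
  have hδ0 : 0 ≤ δ := by positivity
  set P : ℝ := ((A * q : ℕ) : ℝ) with hP
  have hP0 : 0 ≤ P := by positivity
  have hΛ0 : 0 ≤ Λ := by linarith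
  have f1 : Λ ^ n * P ^ m * ‖lcF n b' (Complex.I * ((p : ℂ) / q)) γ‖ ≤ (P ^ m * κ ^ (m * n)) * δ := by
    calc _ ≤ Λ ^ (n + m) * P ^ m * (S * δ) := by
          have := pow_le_pow_right₀ hΛ (by omega : n ≤ n + m)
          gcongr
      _ = P ^ m * (S * Λ ^ (n + m)) * δ := by ring
      _ ≤ _ := by gcongr
  have f2 : ((n:ℝ)+1) * (m+1) * H * P ^ m * Λ ^ (n + m) ≤ P ^ m * κ ^ (m * n) := by
    have g1 : ((n:ℝ)+1) * (m+1) * H ≤ S := le_mul_of_one_le_right (by positivity) (one_le_pow₀ hA1)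
    calc _ ≤ S * P ^ m * Λ ^ (n + m) := by gcongr
      _ = P ^ m * (S * Λ ^ (n + m)) := by ring
      _ ≤ _ := by gcongr
  have hκ0 : 0 ≤ κ := by positivity
  calc (1 : ℝ) ≤ _ := key
    _ ≤ ((P ^ m * κ ^ (m * n)) * δ) * (P ^ m * κ ^ (m * n)) ^ D := by
        gcongr
    _ = _ := by ring

theorem lc_main (α : ℝ) (hγ : IsAlgebraic ℚ (Complex.exp (Complex.I * α)))
    (hγ1 : Complex.exp (Complex.I * α) ≠ 1) :
    ∃ (E : ℕ) (c : ℝ), 0 < c ∧ ∀ (p : ℤ) (q : ℕ), 1 ≤ q → |α - p / q| ≤ 1 →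
      c / (q : ℝ) ^ E ≤ |α - p / q| := by
  obtain ⟨D, A, κ, hA, hκ, hstep⟩ := lc_step α hγ hγ1
  obtain ⟨m, hm⟩ := exists_nat_ge (2 * ((2 * κ) ^ (D + 1) * Real.exp A))
  have hκ0 : (0 : ℝ) < κ := by linarith
  have hA' : (1 : ℝ) ≤ A := by exact_mod_cast hA
  have hm0 : (0 : ℝ) < m := lt_of_lt_of_le (by positivity) hm
  have hm1 : 1 ≤ m := by exact_mod_cast hm0
  obtain ⟨s, hs⟩ := pow_unbounded_of_one_lt (2 * κ) (show (1:ℝ) < 2 by norm_num)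
  set E := s * (m * (D + 1)) with hE
  refine ⟨E, 1 / (2 * m * (2 ^ (m + 1) * A : ℝ) ^ E), by positivity, ?_⟩
  intro p q hq hε
  set n := Nat.log 2 (A * q) + 1 + m with hn
  have hmn : m ≤ n := by omega
  have hn1 : 1 ≤ n := by omega
  have hq1 : (1 : ℝ) ≤ q := by exact_mod_cast hq
  have hAq : A * q ≠ 0 := by positivity
  have hPn : ((A * q : ℕ) : ℝ) ≤ 2 ^ n := by
    have : A * q < 2 ^ (Nat.log 2 (A * q) + 1) := Nat.lt_pow_succ_log_self (by norm_num) _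
    have h2 : 2 ^ (Nat.log 2 (A * q) + 1) ≤ 2 ^ n := Nat.pow_le_pow_right (by norm_num) (by omega)
    exact_mod_cast this.le.trans h2
  have hnP : (2 : ℝ) ^ n ≤ 2 ^ (m + 1) * A * q := by
    have : 2 ^ Nat.log 2 (A * q) ≤ A * q := Nat.pow_log_le_self 2 hAq
    have h2 : 2 ^ n ≤ 2 ^ (m + 1) * (A * q) := by
      rw [hn, show Nat.log 2 (A * q) + 1 + m = (m + 1) + Nat.log 2 (A * q) by ring, pow_add]
      gcongr
    rw [mul_assoc]
    exact_mod_cast h2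
  have key := hstep n m hm1 hmn p q hq hε
  set ε := |α - p / q| with hεd
  have hε0 : 0 ≤ ε := abs_nonneg _
  set Q : ℝ := ((2 * κ) ^ (D + 1)) ^ (m * n) with hQ
  have hQ0 : 0 < Q := by positivity
  have h1 : (((A * q : ℕ) : ℝ) ^ m * κ ^ (m * n)) ^ (D + 1) ≤ Q := by
    have : ((A * q : ℕ) : ℝ) ^ m * κ ^ (m * n) ≤ (2 * κ) ^ (m * n) := by
      rw [mul_pow]
      gcongr
      rw [mul_comm m n, pow_mul]
      gcongr
    refine (pow_le_pow_left₀ (by positivity) this (D + 1)).trans (le_of_eq ?_)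
    rw [hQ, ← pow_mul, ← pow_mul, mul_comm (D + 1)]
  have h2 : Q * (Real.exp A / m) ^ (m * n) ≤ 1 / 2 := by
    rw [hQ, ← mul_pow]
    have h3 : (2 * κ) ^ (D + 1) * (Real.exp A / m) ≤ 1 / 2 := by
      rw [← mul_div_assoc, div_le_iff₀ hm0]; linarith
    have h4 : 1 ≤ m * n := Nat.mul_pos hm1 hn1
    calc _ ≤ (1 / 2 : ℝ) ^ (m * n) := by gcongr
      _ ≤ (1 / 2 : ℝ) ^ 1 := pow_le_pow_of_le_one (by norm_num) (by norm_num) h4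
      _ = 1 / 2 := by norm_num
  have h5 : Q ≤ (2 ^ (m + 1) * A * q : ℝ) ^ E := by
    calc Q = (2 * κ) ^ (n * (m * (D + 1))) := by rw [hQ, ← pow_mul]; congr 1; ring
      _ ≤ ((2 : ℝ) ^ s) ^ (n * (m * (D + 1))) := by gcongr
      _ = ((2 : ℝ) ^ n) ^ E := by rw [← pow_mul, ← pow_mul, hE]; congr 1; ring
      _ ≤ _ := by gcongr
  have h6 : 1 ≤ Q * (Real.exp A / m) ^ (m * n) + Q * (m * ε) := by
    rw [← mul_add]
    refine key.trans ?_
    gcongr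
  have h7 : 1 ≤ 2 * m * (2 ^ (m + 1) * A * q : ℝ) ^ E * ε := by
    have : Q * (m * ε) ≤ (2 ^ (m + 1) * A * q : ℝ) ^ E * (m * ε) := by gcongr
    linarith
  rw [div_div, div_le_iff₀ (by positivity)]
  rw [mul_pow] at h7
  linarith

theorem lc_not_liouville (α : ℝ) (hγ : IsAlgebraic ℚ (Complex.exp (Complex.I * α)))
    (hγ1 : Complex.exp (Complex.I * α) ≠ 1) (hL : ∀ r : ℝ, LiouvilleWith r α) : False := by
  obtain ⟨E, c, hc, hmain⟩ := lc_main α hγ hγ1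
  obtain ⟨C, hC0, hC⟩ := (hL ((E + 1 : ℕ) : ℝ)).exists_pos
  have hev : ∀ᶠ q : ℕ in Filter.atTop, C / c + C < q := by
    obtain ⟨N, hN⟩ := exists_nat_gt (C / c + C)
    filter_upwards [Filter.eventually_ge_atTop N] with q hq
    have : (N : ℝ) ≤ q := by exact_mod_cast hq
    linarith
  obtain ⟨q, ⟨hq1, p, -, hlt⟩, hq⟩ := (hC.and_eventually hev).exists
  have hq' : (1 : ℝ) ≤ q := by exact_mod_cast hq1
  rw [Real.rpow_natCast] at hlt
  have hCc : 0 < C / c := by positivity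
  have hqE : 1 ≤ (q : ℝ) ^ E := one_le_pow₀ hq'
  have h1 : |α - p / q| ≤ 1 := by
    refine hlt.le.trans ?_
    rw [div_le_one (by positivity), pow_succ]
    nlinarith
  have h2 := (hmain p q hq1 h1).trans_lt hlt
  rw [div_lt_div_iff₀ (by positivity) (by positivity), pow_succ] at h2
  have h3 : C < c * q := by
    have : C / c < q := by linarith
    rwa [div_lt_iff₀' hc] at this
  nlinarith

theorem lc_exp_algebraic (α : ℝ) (h : IsAlgebraic ℚ (Real.cos α)) :
    IsAlgebraic ℚ (Complex.exp (Complex.I * α)) := by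
  have h1 : IsAlgebraic ℚ (Complex.cos α) := by
    rw [← Complex.ofReal_cos]; exact h.algebraMap
  have hI : IsAlgebraic ℚ Complex.I := by
    refine IsAlgebraic.of_pow (n := 2) (by norm_num) ?_
    rw [Complex.I_sq]; exact (isAlgebraic_one).neg
  have h2 : IsAlgebraic ℚ (Complex.sin α) := by
    refine IsAlgebraic.of_pow (n := 2) (by norm_num) ?_
    rw [Complex.sin_sq]
    exact isAlgebraic_one.sub (h1.pow 2)
  rw [mul_comm, Complex.exp_mul_I]
  exact h1.add (h2.mul hI)

theorem liouville_cos_transcendental (α : ℝ) (h : Liouville α) :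
    Transcendental ℚ (Real.cos α) := by
  intro halg
  have hγ := lc_exp_algebraic α halg
  have hL : ∀ r : ℝ, LiouvilleWith r α := fun r => h.liouvilleWith r
  by_cases h1 : Complex.exp (Complex.I * α) = 1
  · obtain ⟨k, hk⟩ := Complex.exp_eq_one_iff.1 h1
    have hk' : α = k * (2 * Real.pi) := by
      have : (α : ℂ) = k * (2 * Real.pi) := by
        apply mul_left_cancel₀ Complex.I_ne_zero
        rw [hk]; ring
      exact_mod_cast this
    have hα0 : α ≠ 0 := fun h0 => h.irrational.ne_zero h0
    have hk0 : k ≠ 0 := by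
      rintro rfl
      apply hα0; rw [hk']; simp
    have hk0' : (k : ℝ) ≠ 0 := by exact_mod_cast hk0
    have hr : (1 / (2 * k) : ℚ) ≠ 0 := by
      have : (k : ℚ) ≠ 0 := by exact_mod_cast hk0
      positivity
    have hpi : α * ((1 / (2 * k) : ℚ) : ℝ) = Real.pi := by
      rw [hk']; push_cast; field_simp
    have he : Complex.exp (Complex.I * (Real.pi : ℝ)) = -1 := by
      rw [mul_comm]; exact Complex.exp_pi_mul_I
    refine lc_not_liouville Real.pi ?_ ?_ ?_
    · rw [he]; exact isAlgebraic_one.neg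
    · rw [he]; norm_num
    · intro r
      rw [← hpi]
      exact (hL r).mul_rat hr
  · exact lc_not_liouville α hγ h1 hL
end

section
/- If α is a Liouville number, then tan α is transcendental. -/
/-- The regular part at the node `j` of the rational function with poles `S`. -/
noncomputable def GG (j : ℕ) (S : Multiset ℕ) : PowerSeries ℂ :=
  (S.map (fun a => if a = j then 1 else (PowerSeries.C ((j : ℂ) - a) + PowerSeries.X)⁻¹)).prod

/-- Coefficients of the exponential polynomial. -/
noncomputable def pc (j : ℕ) (S : Multiset ℕ) (k : ℕ) : ℂ :=
  if k < S.count j then PowerSeries.coeff (S.count j - 1 - k) (GG j S) / (k.factorial : ℂ) else 0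

/-- The exponential polynomial along the imaginary axis. -/
noncomputable def ff (n M : ℕ) (S : Multiset ℕ) (y : ℝ) : ℂ :=
  ∑ j ∈ Finset.range (n + 1), ∑ k ∈ Finset.range M,
    pc j S k * Complex.exp (j * (Complex.I * y)) * (Complex.I * y) ^ k

lemma GG_cons_self (j : ℕ) (S : Multiset ℕ) : GG j (j ::ₘ S) = GG j S := by
  simp [GG]

lemma GG_cons_ne {a j : ℕ} (h : a ≠ j) (S : Multiset ℕ) :
    (PowerSeries.C ((j : ℂ) - a) + PowerSeries.X) * GG j (a ::ₘ S) = GG j S := by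
  have h2 : ((j : ℂ) - a) ≠ 0 := sub_ne_zero.mpr (by exact_mod_cast h.symm)
  simp only [GG, Multiset.map_cons, Multiset.prod_cons, if_neg h]
  rw [← mul_assoc, PowerSeries.mul_inv_cancel _ (by simpa using h2), one_mul]

lemma coeff_lin_mul_zero (d : ℂ) (g : PowerSeries ℂ) :
    PowerSeries.coeff 0 ((PowerSeries.C d + PowerSeries.X) * g) = d * PowerSeries.coeff 0 g := by
  simp [add_mul]

lemma coeff_lin_mul_succ (d : ℂ) (g : PowerSeries ℂ) (s : ℕ) :
    PowerSeries.coeff (s + 1) ((PowerSeries.C d + PowerSeries.X) * g)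
      = d * PowerSeries.coeff (s + 1) g + PowerSeries.coeff s g := by
  rw [add_mul, map_add, PowerSeries.coeff_C_mul, PowerSeries.coeff_succ_X_mul]

lemma pc_rec (j a : ℕ) (S : Multiset ℕ) (k : ℕ) :
    ((k : ℂ) + 1) * pc j (a ::ₘ S) (k + 1) + ((j : ℂ) - a) * pc j (a ::ₘ S) k = pc j S k := by
  have hk : ((k : ℂ) + 1) ≠ 0 := by exact_mod_cast Nat.succ_ne_zero k
  have hkf : (k.factorial : ℂ) ≠ 0 := by exact_mod_cast Nat.factorial_ne_zero k
  by_cases h : a = j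
  · subst h
    simp only [sub_self, zero_mul, add_zero, pc, Multiset.count_cons_self, GG_cons_self,
      Nat.add_lt_add_iff_right]
    split_ifs with h1
    · rw [show S.count a + 1 - 1 - (k + 1) = S.count a - 1 - k by omega, Nat.factorial_succ]
      push_cast
      field_simp
    · simp
  · have hc : (a ::ₘ S).count j = S.count j := Multiset.count_cons_of_ne (Ne.symm h) S
    simp only [pc, hc]
    rw [← GG_cons_ne h S]
    set g := GG j (a ::ₘ S)
    by_cases h1 : k < S.count j
    · by_cases h2 : k + 1 < S.count j
      · obtain ⟨s, hs⟩ : ∃ s, S.count j = k + 1 + s + 1 := ⟨S.count j - (k + 2), by omega⟩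
        rw [if_pos h2, if_pos h1, if_pos h1, hs, show k + 1 + s + 1 - 1 - (k + 1) = s by omega,
          show k + 1 + s + 1 - 1 - k = s + 1 by omega, coeff_lin_mul_succ, Nat.factorial_succ]
        push_cast
        field_simp
        ring
      · have hs : S.count j = k + 1 := by omega
        rw [if_neg h2, if_pos h1, if_pos h1, hs, show k + 1 - 1 - k = 0 by omega,
          coeff_lin_mul_zero]
        ring
    · rw [if_neg h1, if_neg h1, if_neg (by omega)]
      ring

lemma pc_eq_zero {j : ℕ} {S : Multiset ℕ} {k : ℕ} (h : S.count j ≤ k) : pc j S k = 0 := by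
  simp [pc, not_lt.mpr h]

lemma ff_zero (n M : ℕ) (S : Multiset ℕ) :
    ff n (M + 1) S 0 = ∑ j ∈ Finset.range (n + 1), pc j S 0 := by
  unfold ff
  refine Finset.sum_congr rfl fun j _ => ?_
  rw [Finset.sum_range_succ']
  simp

lemma pc_replicate_zero (j a r : ℕ) :
    pc j (Multiset.replicate (r + 1) a) 0 = if j = a then (if r = 0 then 1 else 0) else 0 := by
  by_cases h : j = a
  · subst h
    have : GG j (Multiset.replicate (r + 1) j) = 1 := by simp [GG]
    rw [pc, this, Multiset.count_replicate_self, PowerSeries.coeff_one]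
    simp
  · rw [if_neg h, pc_eq_zero]
    rw [Multiset.count_replicate, if_neg (Ne.symm h)]

lemma sum_pc_zero (n : ℕ) : ∀ (r : ℕ) (S : Multiset ℕ), S.card = r + 1 → (∀ a ∈ S, a ≤ n) →
    ∑ j ∈ Finset.range (n + 1), pc j S 0 = if r = 0 then 1 else 0 := by
  intro r
  induction r with
  | zero =>
    intro S hS hn
    obtain ⟨a, rfl⟩ := Multiset.card_eq_one.mp hS
    have h1 : ∀ j, pc j {a} 0 = if j = a then 1 else 0 := fun j => by
      simpa using pc_replicate_zero j a 0
    have := hn a (by simp)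
    simp only [h1]
    rw [Finset.sum_ite_eq']
    simp; omega
  | succ r ih =>
    intro S hS hn
    obtain ⟨a, ha⟩ : ∃ a, a ∈ S := Multiset.card_pos_iff_exists_mem.mp (by omega)
    by_cases hall : ∀ b ∈ S, b = a
    · have hrep : S = Multiset.replicate (r + 1 + 1) a := Multiset.eq_replicate.mpr ⟨hS, hall⟩
      rw [hrep]
      simp only [pc_replicate_zero]
      simp
    · push Not at hall
      obtain ⟨b, hb, hba⟩ := hall
      obtain ⟨U, rfl⟩ := Multiset.exists_cons_of_mem ha
      have hbU : b ∈ U := by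
        rcases Multiset.mem_cons.mp hb with h | h
        · exact absurd h hba
        · exact h
      obtain ⟨V, rfl⟩ := Multiset.exists_cons_of_mem hbU
      simp only [Multiset.card_cons] at hS
      have hbac : ((b : ℂ) - a) ≠ 0 := sub_ne_zero.mpr (by exact_mod_cast hba)
      have e1 := ih (b ::ₘ V) (by simp; omega) (fun c hc => hn c (by simp at hc ⊢; tauto))
      have e2 := ih (a ::ₘ V) (by simp; omega) (fun c hc => hn c (by simp at hc ⊢; tauto))
      have key : ∀ j, ((b : ℂ) - a) * pc j (a ::ₘ b ::ₘ V) 0 = pc j (b ::ₘ V) 0 - pc j (a ::ₘ V) 0 := by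
        intro j
        have r1 := pc_rec j a (b ::ₘ V) 0
        have r2 := pc_rec j b (a ::ₘ V) 0
        rw [Multiset.cons_swap] at r2
        rw [← r1, ← r2]
        ring
      have : ((b : ℂ) - a) * ∑ j ∈ Finset.range (n + 1), pc j (a ::ₘ b ::ₘ V) 0 = 0 := by
        rw [Finset.mul_sum]
        simp only [key]
        rw [Finset.sum_sub_distrib, e1, e2, sub_self]
      simpa [hbac] using this

lemma ff_hasDerivAt (n M a : ℕ) (S : Multiset ℕ) (hM : ∀ j, (a ::ₘ S).count j ≤ M) (y : ℝ) :
    HasDerivAt (fun y : ℝ => Complex.exp (-(a * (Complex.I * y))) * ff n M (a ::ₘ S) y)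
      (Complex.I * Complex.exp (-(a * (Complex.I * y))) * ff n M S y) y := by
  have h0 : HasDerivAt (fun y : ℝ => Complex.I * (y : ℂ)) Complex.I y := by
    simpa using (Complex.ofRealCLM.hasDerivAt (x := y)).const_mul Complex.I
  have hE : HasDerivAt (fun y : ℝ => Complex.exp (-(a * (Complex.I * y))))
      (Complex.exp (-(a * (Complex.I * y))) * (-(a * Complex.I))) y :=
    ((h0.const_mul (a : ℂ)).fun_neg).cexp
  have hF : HasDerivAt (fun y : ℝ => ff n M (a ::ₘ S) y)
      (∑ j ∈ Finset.range (n + 1), ∑ k ∈ Finset.range M,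
        (pc j (a ::ₘ S) k * (Complex.exp (j * (Complex.I * y)) * (j * Complex.I)) *
            (Complex.I * y) ^ k +
          pc j (a ::ₘ S) k * Complex.exp (j * (Complex.I * y)) *
            (k * (Complex.I * y) ^ (k - 1) * Complex.I))) y := by
    unfold ff
    refine HasDerivAt.fun_sum fun j _ => HasDerivAt.fun_sum fun k _ => ?_
    exact (((h0.const_mul (j : ℂ)).cexp).const_mul _).mul (h0.fun_pow k)
  refine (hE.mul hF).congr_deriv ?_
  have inner : ∀ j : ℕ, ∑ k ∈ Finset.range M,
        (pc j (a ::ₘ S) k * (Complex.exp (j * (Complex.I * y)) * (j * Complex.I)) *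
            (Complex.I * y) ^ k +
          pc j (a ::ₘ S) k * Complex.exp (j * (Complex.I * y)) *
            (k * (Complex.I * y) ^ (k - 1) * Complex.I))
      = Complex.I * (∑ k ∈ Finset.range M, pc j S k * Complex.exp (j * (Complex.I * y)) * (Complex.I * y) ^ k)
        + a * Complex.I * (∑ k ∈ Finset.range M,
          pc j (a ::ₘ S) k * Complex.exp (j * (Complex.I * y)) * (Complex.I * y) ^ k) := by
    intro j
    have shift : ∑ k ∈ Finset.range M, pc j (a ::ₘ S) k * Complex.exp (j * (Complex.I * y)) *
            (k * (Complex.I * y) ^ (k - 1) * Complex.I)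
        = ∑ k ∈ Finset.range M, pc j (a ::ₘ S) (k + 1) * Complex.exp (j * (Complex.I * y)) *
            ((k + 1) * (Complex.I * y) ^ k * Complex.I) := by
      have e1 := Finset.sum_range_succ' (fun k : ℕ => pc j (a ::ₘ S) k * Complex.exp (j * (Complex.I * y)) *
            (k * (Complex.I * y) ^ (k - 1) * Complex.I)) M
      rw [Finset.sum_range_succ, pc_eq_zero (hM j)] at e1
      simpa using e1
    rw [Finset.sum_add_distrib, shift, Finset.mul_sum, Finset.mul_sum, ← Finset.sum_add_distrib,
      ← Finset.sum_add_distrib]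
    refine Finset.sum_congr rfl fun k _ => ?_
    rw [← pc_rec j a S k]
    ring
  simp only [inner]
  rw [Finset.sum_add_distrib, ← Finset.mul_sum, ← Finset.mul_sum]
  unfold ff
  ring

lemma ff_bound (n M : ℕ) : ∀ (r : ℕ) (S : Multiset ℕ), S.card = r + 1 → (∀ a ∈ S, a ≤ n) →
    (∀ j, S.count j ≤ M + 1) → ∀ y : ℝ, 0 ≤ y → ‖ff n (M + 1) S y‖ ≤ y ^ r / (r.factorial : ℝ) := by
  intro r
  induction r with
  | zero =>
    intro S hS hn hM y hy
    obtain ⟨a, rfl⟩ := Multiset.card_eq_one.mp hS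
    have han := hn a (by simp)
    have h1 : ∀ j k, pc j {a} k = if j = a then (if k = 0 then 1 else 0) else 0 := fun j k => by
      by_cases hk : k = 0
      · subst hk
        simpa using pc_replicate_zero j a 0
      · rw [pc_eq_zero]
        · simp [hk]
        · rw [Multiset.count_singleton]
          split_ifs <;> omega
    have : ff n (M + 1) {a} y = Complex.exp (a * (Complex.I * y)) := by
      unfold ff
      rw [Finset.sum_eq_single a, Finset.sum_eq_single 0]
      · simp [h1]
      · intro k _ hk
        simp [h1, hk]
      · simp
      · intro j _ hj
        simp [h1, hj]
      · intro h
        simp at h; omega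
    rw [this]
    have e : (a : ℂ) * (Complex.I * y) = ((a * y : ℝ) : ℂ) * Complex.I := by push_cast; ring
    rw [e, Complex.norm_exp_ofReal_mul_I]
    simp
  | succ r ih =>
    intro S hS hn hM y hy
    obtain ⟨a, ha⟩ : ∃ a, a ∈ S := Multiset.card_pos_iff_exists_mem.mp (by omega)
    have hz := sum_pc_zero n (r + 1) S hS hn
    obtain ⟨U, rfl⟩ := Multiset.exists_cons_of_mem ha
    have hU : ∀ y : ℝ, 0 ≤ y → ‖ff n (M + 1) U y‖ ≤ y ^ r / (r.factorial : ℝ) := by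
      refine ih U (by simpa using hS) (fun c hc => hn c (by simp [hc])) (fun j => ?_)
      exact (Multiset.count_le_count_cons j a U).trans (hM j)
    have hnorm : ∀ x : ℝ, ‖Complex.exp (-(a * (Complex.I * x)))‖ = 1 := by
      intro x
      have e : -((a : ℂ) * (Complex.I * x)) = ((-(a * x) : ℝ) : ℂ) * Complex.I := by push_cast; ring
      rw [e, Complex.norm_exp_ofReal_mul_I]
    have hd := ff_hasDerivAt n (M + 1) a U hM
    have := image_norm_le_of_norm_deriv_right_le_deriv_boundary
      (a := 0) (b := y)
      (f := fun y : ℝ => Complex.exp (-(a * (Complex.I * y))) * ff n (M + 1) (a ::ₘ U) y)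
      (f' := fun y : ℝ => Complex.I * Complex.exp (-(a * (Complex.I * y))) * ff n (M + 1) U y)
      (B := fun x => x ^ (r + 1) / ((r + 1).factorial : ℝ)) (B' := fun x => x ^ r / (r.factorial : ℝ))
      (fun x _ => (hd x).continuousAt.continuousWithinAt)
      (fun x _ => (hd x).hasDerivWithinAt)
      (by
        simp only [ff_zero, hz]
        simp)
      (by
        intro x
        have h1 := ((hasDerivAt_id x).fun_pow (r + 1)).div_const ((r + 1).factorial : ℝ)
        refine h1.congr_deriv ?_
        rw [Nat.factorial_succ]
        push_cast
        have : ((r : ℝ) + 1) ≠ 0 := by positivity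
        have : (r.factorial : ℝ) ≠ 0 := by positivity
        simp
        field_simp)
      (by
        intro x hx
        rw [norm_mul, norm_mul, hnorm, Complex.norm_I, one_mul, one_mul]
        exact hU x hx.1)
      (Set.right_mem_Icc.mpr hy)
    rw [norm_mul, hnorm, one_mul] at this
    exact this

/-- A polynomial of degree at most `N` which vanishes to order `N` at `1` has no other root. -/
lemma poly_no_root (D : Polynomial ℂ) (N : ℕ) (hD : D ≠ 0) (hdeg : D.natDegree ≤ N)
    (hO : (fun y : ℝ => D.eval (Complex.exp (Complex.I * y))) =O[nhdsWithin 0 (Set.Ioi 0)]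
      (fun y : ℝ => y ^ N)) (β : ℂ) (hβ : β ≠ 1) : D.eval β ≠ 0 := by
  obtain ⟨g, hg, hndvd⟩ := Polynomial.exists_eq_pow_rootMultiplicity_mul_and_not_dvd D hD 1
  set a := D.rootMultiplicity 1
  have hg1 : g.eval 1 ≠ 0 := fun h => hndvd (Polynomial.dvd_iff_isRoot.mpr h)
  have hg0 : g ≠ 0 := by rintro rfl; simp at hg1
  have hmon : ((Polynomial.X - Polynomial.C (1 : ℂ)) ^ a).Monic := (Polynomial.monic_X_sub_C 1).pow a
  have hdg : D.natDegree = a + g.natDegree := by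
    rw [hg, hmon.natDegree_mul' hg0, Polynomial.natDegree_pow, Polynomial.natDegree_X_sub_C, mul_one]
  have haN : N ≤ a := by
    by_contra hlt
    push Not at hlt
    have h0 : HasDerivAt (fun y : ℝ => Complex.exp (Complex.I * (y : ℂ))) Complex.I 0 := by
      have h1 : HasDerivAt (fun y : ℝ => Complex.I * (y : ℂ)) Complex.I 0 := by
        simpa using (Complex.ofRealCLM.hasDerivAt (x := (0 : ℝ))).const_mul Complex.I
      simpa using h1.cexp
    have hs : Filter.Tendsto (fun y : ℝ => (y : ℂ)⁻¹ * (Complex.exp (Complex.I * y) - 1))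
        (nhdsWithin 0 (Set.Ioi 0)) (nhds Complex.I) := by
      have := h0.tendsto_slope_zero_right
      simpa using this
    have hc : Filter.Tendsto (fun y : ℝ => g.eval (Complex.exp (Complex.I * y)))
        (nhdsWithin 0 (Set.Ioi 0)) (nhds (g.eval 1)) := by
      have : Continuous (fun y : ℝ => g.eval (Complex.exp (Complex.I * y))) :=
        g.continuous.comp (by fun_prop)
      have h2 := this.tendsto 0
      simp only [Complex.ofReal_zero, mul_zero, Complex.exp_zero] at h2
      exact h2.mono_left nhdsWithin_le_nhds
    have hl := (hs.pow a).mul hc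
    have hO2 : (fun y : ℝ => ((y : ℂ)⁻¹ * (Complex.exp (Complex.I * y) - 1)) ^ a *
        g.eval (Complex.exp (Complex.I * y))) =O[nhdsWithin 0 (Set.Ioi 0)]
          (fun y : ℝ => y ^ (N - a)) := by
      have h3' : (fun y : ℝ => ((y : ℂ)⁻¹) ^ a) =O[nhdsWithin 0 (Set.Ioi 0)]
          (fun y : ℝ => (y⁻¹) ^ a) := Asymptotics.isBigO_of_le _ fun y => by simp
      have h3 := h3'.mul hO
      refine (h3.congr' (Filter.Eventually.of_forall fun y => ?_) Filter.EventuallyEq.rfl).trans ?_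
      · rw [hg]
        simp only [Polynomial.eval_mul, Polynomial.eval_pow, Polynomial.eval_sub, Polynomial.eval_X,
          Polynomial.eval_C, mul_pow]
        ring
      · refine Asymptotics.IsBigO.of_bound 1 ?_
        filter_upwards [self_mem_nhdsWithin] with y hy
        have hy : (0 : ℝ) < y := hy
        rw [one_mul, norm_mul, norm_pow, norm_inv, norm_pow, norm_pow]
        have : N = (N - a) + a := by omega
        conv_lhs => rw [this]
        rw [pow_add, inv_pow]
        have : ‖y‖ ^ a ≠ 0 := pow_ne_zero _ (norm_ne_zero_iff.mpr hy.ne')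
        field_simp
        rfl
    have ht : Filter.Tendsto (fun y : ℝ => y ^ (N - a)) (nhdsWithin 0 (Set.Ioi 0)) (nhds 0) := by
      have : Filter.Tendsto (fun y : ℝ => y ^ (N - a)) (nhds 0) (nhds (0 ^ (N - a))) :=
        (continuous_pow (N - a)).tendsto 0
      rw [zero_pow (by omega)] at this
      exact this.mono_left nhdsWithin_le_nhds
    have := tendsto_nhds_unique hl (hO2.trans_tendsto ht)
    exact (mul_ne_zero (pow_ne_zero a Complex.I_ne_zero) hg1) this
  have hgd : g.natDegree = 0 := by omega
  obtain ⟨c, hc⟩ : ∃ c, g = Polynomial.C c := ⟨_, Polynomial.eq_C_of_natDegree_eq_zero hgd⟩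
  have hc0 : c ≠ 0 := by rintro rfl; simp at hc; exact hg0 hc
  rw [hg, hc]
  simp only [Polynomial.eval_mul, Polynomial.eval_pow, Polynomial.eval_sub, Polynomial.eval_X,
          Polynomial.eval_C]
  exact mul_ne_zero (pow_ne_zero _ (sub_ne_zero.mpr hβ)) hc0

/-- The multiset of nodes: `0, …, n-1` with multiplicity `m+1` and `n` with multiplicity `l+1`. -/
def SS (n m l : ℕ) : Multiset ℕ := (m + 1) • Multiset.range n + Multiset.replicate (l + 1) n

lemma SS_card (n m l : ℕ) : (SS n m l).card = (m + 1) * n + l + 1 := by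
  simp [SS, add_assoc]

lemma SS_le (n m l : ℕ) : ∀ a ∈ SS n m l, a ≤ n := by
  intro a ha
  rw [SS, Multiset.mem_add] at ha
  rcases ha with h | h
  · have := Multiset.mem_of_mem_nsmul h
    simp at this
    omega
  · exact (Multiset.eq_of_mem_replicate h).le

lemma SS_count_n (n m l : ℕ) : (SS n m l).count n = l + 1 := by
  rw [SS, Multiset.count_add, Multiset.count_nsmul, Multiset.count_replicate_self,
    Multiset.count_eq_zero_of_notMem (by simp)]
  simp

lemma SS_count_le (n m l : ℕ) (hl : l ≤ m) (j : ℕ) : (SS n m l).count j ≤ m + 1 := by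
  by_cases h : j = n
  · subst h
    rw [SS_count_n]; omega
  · rw [SS, Multiset.count_add, Multiset.count_nsmul, Multiset.count_replicate,
      if_neg (Ne.symm h)]
    have : (Multiset.range n).count j ≤ 1 := Multiset.nodup_iff_count_le_one.mp (Multiset.nodup_range n) j
    simp only [add_zero]
    nlinarith

/-- The polynomial matrix. -/
noncomputable def PP (n m : ℕ) : Matrix (Fin (m + 1)) (Fin (m + 1)) (Polynomial ℂ) :=
  fun l k => ∑ j ∈ Finset.range (n + 1), Polynomial.C (pc j (SS n m l) k) * Polynomial.X ^ j

lemma PP_eval (n m : ℕ) (l k : Fin (m + 1)) (x : ℂ) :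
    (PP n m l k).eval x = ∑ j ∈ Finset.range (n + 1), pc j (SS n m l) k * x ^ j := by
  simp [PP, Polynomial.eval_finsetSum]

lemma PP_coeff (n m : ℕ) (l k : Fin (m + 1)) :
    (PP n m l k).coeff n = pc n (SS n m l) k := by
  simp [PP, Polynomial.finsetSum_coeff, Polynomial.coeff_C_mul, Polynomial.coeff_X_pow]

lemma PP_natDegree (n m : ℕ) (l k : Fin (m + 1)) : (PP n m l k).natDegree ≤ n := by
  refine Polynomial.natDegree_sum_le_of_forall_le _ _ fun j hj => ?_
  have := Finset.mem_range.mp hj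
  exact (Polynomial.natDegree_C_mul_X_pow_le _ _).trans (by omega)

lemma GG_coeff_zero_ne (j : ℕ) (S : Multiset ℕ) : PowerSeries.coeff 0 (GG j S) ≠ 0 := by
  induction S using Multiset.induction_on with
  | empty => simp [GG]
  | cons a S ih =>
    by_cases h : a = j
    · subst h; rwa [GG_cons_self]
    · rw [← GG_cons_ne h S, coeff_lin_mul_zero] at ih
      exact right_ne_zero_of_mul ih

lemma PP_det_coeff (n m : ℕ) : (PP n m).det.coeff ((m + 1) * n) ≠ 0 := by
  have h1 : (PP n m).det.coeff ((m + 1) * n)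
      = (Matrix.of fun l k : Fin (m + 1) => pc n (SS n m l) k).det := by
    rw [Matrix.det_apply, Matrix.det_apply, Polynomial.finsetSum_coeff]
    refine Finset.sum_congr rfl fun σ _ => ?_
    rw [Polynomial.coeff_smul]
    congr 1
    have := Polynomial.coeff_prod_of_natDegree_le (Finset.univ : Finset (Fin (m + 1)))
      (fun i => PP n m (σ i) i) n (fun i _ => PP_natDegree n m _ _)
    simp only [Finset.card_univ, Fintype.card_fin] at this
    rw [this]
    refine Finset.prod_congr rfl fun i _ => ?_
    rw [PP_coeff]
    rfl
  rw [h1, Matrix.det_of_isLowerTriangular]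
  · refine Finset.prod_ne_zero_iff.mpr fun i _ => ?_
    have hf : ((i : ℕ).factorial : ℂ) ≠ 0 := by exact_mod_cast Nat.factorial_ne_zero _
    simp only [Matrix.of_apply, pc, SS_count_n]
    rw [if_pos (by omega)]
    refine div_ne_zero ?_ hf
    rw [show (i : ℕ) + 1 - 1 - i = 0 by omega]
    exact GG_coeff_zero_ne _ _
  · intro i j hij
    have hij : i < j := hij
    simp only [Matrix.of_apply]
    apply pc_eq_zero
    rw [SS_count_n]
    exact hij

lemma PP_det_natDegree (n m : ℕ) : (PP n m).det.natDegree ≤ (m + 1) * n := by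
  rw [Matrix.det_apply]
  refine Polynomial.natDegree_sum_le_of_forall_le _ _ fun σ _ => ?_
  refine (Polynomial.natDegree_smul_le _ _).trans ?_
  refine (Polynomial.natDegree_prod_le _ _).trans ?_
  refine (Finset.sum_le_card_nsmul _ _ n fun i _ => PP_natDegree n m _ _).trans ?_
  simp

lemma PP_det_isBigO (n m : ℕ) :
    (fun y : ℝ => (PP n m).det.eval (Complex.exp (Complex.I * y))) =O[nhdsWithin 0 (Set.Ioi 0)]
      (fun y : ℝ => y ^ ((m + 1) * n)) := by
  set A : ℝ → Matrix (Fin (m + 1)) (Fin (m + 1)) ℂ := fun y =>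
    (PP n m).map (Polynomial.eval (Complex.exp (Complex.I * y))) with hA
  have hAc : Continuous A := by
    refine continuous_matrix fun l k => ?_
    exact (PP n m l k).continuous.comp (by fun_prop)
  have hdet : ∀ y : ℝ, (PP n m).det.eval (Complex.exp (Complex.I * y)) = (A y).det := by
    intro y
    have := RingHom.map_det (Polynomial.evalRingHom (Complex.exp (Complex.I * y))) (PP n m)
    simpa [hA] using this
  have hmul : ∀ y : ℝ, (A y).mulVec (fun k : Fin (m + 1) => (Complex.I * (y : ℂ)) ^ (k : ℕ))
      = fun l : Fin (m + 1) => ff n (m + 1) (SS n m l) y := by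
    intro y
    ext l
    simp only [Matrix.mulVec, dotProduct, hA, Matrix.map_apply, PP_eval, ff]
    rw [Finset.sum_comm, ← Fin.sum_univ_eq_sum_range (fun k => ∑ j ∈ Finset.range (n + 1), pc j (SS n m l) k * Complex.exp (j * (Complex.I * y)) * (Complex.I * y) ^ k)]
    refine Finset.sum_congr rfl fun k _ => ?_
    rw [Finset.sum_mul]
    refine Finset.sum_congr rfl fun j _ => ?_
    rw [← Complex.exp_nat_mul]
  have hexp : ∀ y : ℝ, (A y).det = ∑ l : Fin (m + 1), (A y).adjugate 0 l * ff n (m + 1) (SS n m l) y := by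
    intro y
    have h1 := congrFun (congrArg (fun v => (A y).adjugate.mulVec v) (hmul y)) 0
    simp only [Matrix.mulVec_mulVec, Matrix.adjugate_mul, Matrix.smul_mulVec, Matrix.one_mulVec] at h1
    simpa [Matrix.mulVec, dotProduct] using h1
  simp only [hdet, hexp]
  refine Asymptotics.IsBigO.fun_sum fun l _ => ?_
  have hadj : (fun y : ℝ => (A y).adjugate 0 l) =O[nhdsWithin 0 (Set.Ioi 0)] (fun _ => (1 : ℝ)) := by
    have : Continuous (fun y : ℝ => (A y).adjugate 0 l) := by
      exact (hAc.matrix_adjugate).matrix_elem 0 l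
    exact (this.tendsto 0).mono_left nhdsWithin_le_nhds |>.isBigO_one ℝ
  have hff : (fun y : ℝ => ff n (m + 1) (SS n m l) y) =O[nhdsWithin 0 (Set.Ioi 0)]
      (fun y : ℝ => y ^ ((m + 1) * n)) := by
    refine Asymptotics.IsBigO.of_bound 1 ?_
    have hI : Set.Ioo (0 : ℝ) 1 ∈ nhdsWithin (0 : ℝ) (Set.Ioi 0) := Ioo_mem_nhdsGT one_pos
    filter_upwards [hI] with y hy
    have hb := ff_bound n m ((m + 1) * n + l) (SS n m l) (SS_card n m l) (SS_le n m l)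
      (SS_count_le n m l (by omega)) y hy.1.le
    rw [one_mul, norm_pow, Real.norm_of_nonneg hy.1.le]
    refine hb.trans ?_
    have h1 : (1 : ℝ) ≤ (((m + 1) * n + l).factorial : ℝ) := by
      exact_mod_cast Nat.one_le_iff_ne_zero.mpr (Nat.factorial_ne_zero _)
    refine (div_le_self (pow_nonneg hy.1.le _) h1).trans ?_
    exact pow_le_pow_of_le_one hy.1.le hy.2.le (by omega)
  simpa using hadj.mul hff

lemma nonvanishing (n m : ℕ) (β : ℂ) (hβ : β ≠ 1) (z : ℂ) :
    ∃ l ≤ m, ∑ j ∈ Finset.range (n + 1), ∑ k ∈ Finset.range (m + 1),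
      pc j (SS n m l) k * β ^ j * z ^ k ≠ 0 := by
  by_contra hcon
  push Not at hcon
  have hD : (PP n m).det ≠ 0 := by
    intro h
    have := PP_det_coeff n m
    rw [h] at this
    simp at this
  have h1 := poly_no_root _ _ hD (PP_det_natDegree n m) (PP_det_isBigO n m) β hβ
  have h2 : (PP n m).det.eval β = ((PP n m).map (Polynomial.eval β)).det := by
    have := RingHom.map_det (Polynomial.evalRingHom β) (PP n m)
    simpa using this
  rw [h2] at h1
  apply h1
  refine Matrix.exists_mulVec_eq_zero_iff.mp ⟨fun k : Fin (m + 1) => z ^ (k : ℕ), ?_, ?_⟩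
  · intro h
    have := congrFun h 0
    simp at this
  · ext l
    have := hcon l (by omega)
    rw [Finset.sum_comm] at this
    simp only [Matrix.mulVec, dotProduct, Matrix.map_apply, PP_eval, Pi.zero_apply]
    rw [← this, ← Fin.sum_univ_eq_sum_range (fun k => ∑ j ∈ Finset.range (n + 1), pc j (SS n m l) k * β ^ j * z ^ k)]
    refine Finset.sum_congr rfl fun k _ => ?_
    rw [Finset.sum_mul]

/-- The leading denominator. -/
def wt (j : ℕ) (S : Multiset ℕ) : ℤ := (S.map (fun a => if a = j then 1 else (j : ℤ) - a)).prod

lemma wt_cons_self (j : ℕ) (S : Multiset ℕ) : wt j (j ::ₘ S) = wt j S := by simp [wt]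

lemma wt_cons_ne {a j : ℕ} (h : a ≠ j) (S : Multiset ℕ) :
    wt j (a ::ₘ S) = ((j : ℤ) - a) * wt j S := by simp [wt, h]

lemma GG_rec_zero {a j : ℕ} (h : a ≠ j) (S : Multiset ℕ) :
    ((j : ℂ) - a) * PowerSeries.coeff 0 (GG j (a ::ₘ S)) = PowerSeries.coeff 0 (GG j S) := by
  rw [← GG_cons_ne h S, coeff_lin_mul_zero]

lemma GG_rec_succ {a j : ℕ} (h : a ≠ j) (S : Multiset ℕ) (s : ℕ) :
    ((j : ℂ) - a) * PowerSeries.coeff (s + 1) (GG j (a ::ₘ S))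
      = PowerSeries.coeff (s + 1) (GG j S) - PowerSeries.coeff s (GG j (a ::ₘ S)) := by
  rw [← GG_cons_ne h S, coeff_lin_mul_succ]
  ring

lemma GG_int (j : ℕ) (L : ℤ) (S : Multiset ℕ) (hL : ∀ a ∈ S, a ≠ j → ((j : ℤ) - a) ∣ L) :
    ∀ s, ∃ z : ℤ, PowerSeries.coeff s (GG j S) * wt j S * (L : ℂ) ^ s = z := by
  induction S using Multiset.induction_on with
  | empty =>
    intro s
    by_cases hs : s = 0
    · exact ⟨1, by simp [GG, wt, hs]⟩
    · exact ⟨0, by simp [GG, wt, PowerSeries.coeff_one, hs]⟩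
  | cons a S ih =>
    have ih := ih (fun b hb => hL b (by simp [hb]))
    by_cases h : a = j
    · subst h
      rwa [GG_cons_self, wt_cons_self]
    · obtain ⟨e, he⟩ := hL a (by simp) h
      have heC : (L : ℂ) = ((j : ℂ) - a) * e := by rw [he]; push_cast; ring
      rw [wt_cons_ne h]
      intro s
      induction s with
      | zero =>
        obtain ⟨z, hz⟩ := ih 0
        refine ⟨z, ?_⟩
        rw [← hz, ← GG_rec_zero h S]
        push_cast
        ring
      | succ s ihs =>
        obtain ⟨z, hz⟩ := ih (s + 1)
        obtain ⟨z2, hz2⟩ := ihs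
        refine ⟨z - z2 * e, ?_⟩
        push_cast at hz2 ⊢
        rw [← hz, ← hz2]
        have := GG_rec_succ h S s
        calc _ = (((j : ℂ) - a) * PowerSeries.coeff (s + 1) (GG j (a ::ₘ S))) * wt j S * (L : ℂ) ^ (s + 1) := by ring
          _ = PowerSeries.coeff (s + 1) (GG j S) * wt j S * (L : ℂ) ^ (s + 1)
              - PowerSeries.coeff s (GG j (a ::ₘ S)) * wt j S * (L : ℂ) ^ s * L := by rw [this]; ring
          _ = _ := by rw [heC]; ring

lemma GG_norm (j : ℕ) (S : Multiset ℕ) :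
    ∀ s, ‖PowerSeries.coeff s (GG j S) * wt j S‖ ≤ 2 ^ (S.card + s) := by
  induction S using Multiset.induction_on with
  | empty =>
    intro s
    by_cases hs : s = 0
    · simp [GG, wt, hs]
    · simp [GG, wt, PowerSeries.coeff_one, hs]
  | cons a S ih =>
    by_cases h : a = j
    · subst h
      rw [GG_cons_self, wt_cons_self, Multiset.card_cons]
      intro s
      exact (ih s).trans (pow_le_pow_right₀ (by norm_num) (by omega))
    · rw [wt_cons_ne h, Multiset.card_cons]
      have hd : (1 : ℝ) ≤ ‖((j : ℂ) - a)‖ := by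
        have h1 : ((j : ℂ) - a) = (((j : ℤ) - a : ℤ) : ℂ) := by push_cast; ring
        rw [h1, Complex.norm_intCast]
        have : ((j : ℤ) - a) ≠ 0 := by omega
        exact_mod_cast Int.one_le_abs this
      intro s
      induction s with
      | zero =>
        have e : PowerSeries.coeff 0 (GG j (a ::ₘ S)) * (((j : ℤ) - a) * wt j S : ℤ)
            = PowerSeries.coeff 0 (GG j S) * wt j S := by
          rw [← GG_rec_zero h S]; push_cast; ring
        rw [e]
        exact (ih 0).trans (pow_le_pow_right₀ (by norm_num) (by omega))
      | succ s ihs =>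
        have e : PowerSeries.coeff (s + 1) (GG j (a ::ₘ S)) * (((j : ℤ) - a) * wt j S : ℤ)
            = PowerSeries.coeff (s + 1) (GG j S) * wt j S
              - PowerSeries.coeff s (GG j (a ::ₘ S)) * wt j S := by
          have := GG_rec_succ h S s
          calc _ = (((j : ℂ) - a) * PowerSeries.coeff (s + 1) (GG j (a ::ₘ S))) * wt j S := by
                push_cast; ring
            _ = _ := by rw [this]; ring
        rw [e]
        have h2 : ‖PowerSeries.coeff s (GG j (a ::ₘ S)) * wt j S‖ ≤ 2 ^ (S.card + 1 + s) := by
          refine le_trans ?_ ihs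
          push_cast
          rw [norm_mul, norm_mul, norm_mul]
          refine mul_le_mul_of_nonneg_left ?_ (norm_nonneg _)
          exact le_mul_of_one_le_left (norm_nonneg _) hd
        refine (norm_sub_le _ _).trans ((add_le_add (ih (s + 1)) h2).trans (le_of_eq ?_))
        ring

lemma wt_range_self (j : ℕ) : (wt j (Multiset.range (j + 1))).natAbs = j.factorial := by
  have h : wt j (Multiset.range (j + 1))
      = ∏ i ∈ Finset.range (j + 1), (if i = j then 1 else (j : ℤ) - i) := rfl
  rw [h, Finset.prod_range_succ, if_pos rfl, mul_one, ← Finset.prod_range_reflect,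
    ← Finset.prod_range_add_one_eq_factorial]
  have : ∏ i ∈ Finset.range j, (if j - 1 - i = j then 1 else (j : ℤ) - ((j - 1 - i : ℕ) : ℤ))
      = ((∏ i ∈ Finset.range j, (i + 1) : ℕ) : ℤ) := by
    push_cast
    refine Finset.prod_congr rfl fun i hi => ?_
    have := Finset.mem_range.mp hi
    rw [if_neg (by omega)]
    omega
  rw [this, Int.natAbs_natCast]

lemma wt_range (j r : ℕ) :
    (wt j (Multiset.range (j + r + 1))).natAbs = j.factorial * r.factorial := by
  induction r with
  | zero => simpa using wt_range_self j
  | succ r ih =>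
    rw [show j + (r + 1) + 1 = (j + r + 1) + 1 by ring, Multiset.range_succ, wt_cons_ne (by omega),
      Int.natAbs_mul, ih, Nat.factorial_succ]
    have : ((j : ℤ) - ((j + r + 1 : ℕ) : ℤ)).natAbs = r + 1 := by omega
    rw [this]
    ring

lemma wt_SS (j n m l : ℕ) :
    wt j (SS n m l) = (wt j (Multiset.range n)) ^ (m + 1) * (wt j {n}) ^ (l + 1) := by
  rw [wt, SS, Multiset.map_add, Multiset.prod_add, Multiset.map_nsmul, Multiset.prod_nsmul,
    Multiset.map_replicate, Multiset.prod_replicate]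
  simp [wt]

lemma wt_SS_mul (j n m l : ℕ) (hj : j ≤ n) (hl : l ≤ m) :
    ∃ e : ℤ, wt j (SS n m l) * e = (n.factorial : ℤ) ^ (m + 1) ∧
      e.natAbs ≤ 4 ^ (n * (m + 1)) := by
  have h1 : (wt j (Multiset.range (n + 1))).natAbs * n.choose j = n.factorial := by
    obtain ⟨r, rfl⟩ := Nat.exists_eq_add_of_le hj
    rw [wt_range, mul_comm, ← Nat.add_choose_mul_factorial_mul_factorial, mul_assoc,
      Nat.add_comm j r, ← Nat.choose_symm_add]
  have h2 : wt j (Multiset.range (n + 1)) = wt j (Multiset.range n) * wt j {n} := by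
    simp [wt, Multiset.range_succ, mul_comm]
  obtain ⟨u, hu, hun⟩ : ∃ u : ℤ, wt j (Multiset.range (n + 1)) * u = n.factorial ∧ u.natAbs = n.choose j := by
    rcases Int.natAbs_eq (wt j (Multiset.range (n + 1))) with h | h
    · refine ⟨n.choose j, ?_, by simp⟩
      rw [h, ← h1]; push_cast; ring
    · refine ⟨-(n.choose j), ?_, by simp⟩
      rw [h, ← h1]; push_cast; ring
  refine ⟨(wt j {n}) ^ (m - l) * u ^ (m + 1), ?_, ?_⟩
  · rw [wt_SS, ← hu, h2]
    obtain ⟨d, rfl⟩ := Nat.exists_eq_add_of_le hl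
    rw [show l + d - l = d by omega]
    ring
  · rw [Int.natAbs_mul, Int.natAbs_pow, Int.natAbs_pow, hun]
    have h3 : (wt j {n}).natAbs ≤ 2 ^ n := by
      have hn : n < 2 ^ n := Nat.lt_two_pow_self
      simp only [wt, Multiset.map_singleton, Multiset.prod_singleton]
      split_ifs
      · simpa using Nat.one_le_two_pow
      · omega
    have h4 : n.choose j ≤ 2 ^ n := Nat.choose_le_two_pow n j
    calc _ ≤ (2 ^ n) ^ (m - l) * (2 ^ n) ^ (m + 1) := by gcongr
      _ ≤ (2 ^ n) ^ (m + 1) * (2 ^ n) ^ (m + 1) := by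
        gcongr
        · exact Nat.one_le_two_pow
        · omega
      _ = 4 ^ (n * (m + 1)) := by
        rw [← mul_pow, ← mul_pow, ← pow_mul, mul_comm]
        norm_num [pow_mul, mul_comm]

lemma lcm_bound (n : ℕ) : (Nat.lcmUpto n : ℝ) ≤ 256 ^ n := by
  have h1 := Chebyshev.psi_le_const_mul_self (x := n) (by positivity)
  rw [Chebyshev.psi_eq_log_lcmUpto] at h1
  have h2 : (0 : ℝ) < Nat.lcmUpto n := by exact_mod_cast Nat.lcmUpto_pos n
  rw [← Real.log_le_log_iff h2 (by positivity), Real.log_pow]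
  refine h1.trans ?_
  rw [mul_comm]
  refine mul_le_mul_of_nonneg_left ?_ (by positivity)
  have e4 : Real.log 4 = 2 * Real.log 2 := by
    rw [show (4 : ℝ) = 2 ^ 2 by norm_num, Real.log_pow]; norm_num
  have e256 : Real.log 256 = 8 * Real.log 2 := by
    rw [show (256 : ℝ) = 2 ^ 8 by norm_num, Real.log_pow]; norm_num
  rw [e4, e256]
  have := Real.log_two_gt_d9
  linarith

/-- The common scaling factor. -/
noncomputable def scl (n m : ℕ) : ℕ :=
  m.factorial * n.factorial ^ (m + 1) * Nat.lcmUpto n ^ m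

lemma scl_pc (n m l j k : ℕ) (hj : j ≤ n) (hl : l ≤ m) :
    ∃ z : ℤ, (scl n m : ℂ) * pc j (SS n m l) k = z ∧
      |(z : ℝ)| ≤ (m.factorial * 4 ^ (m + 1)) * 2048 ^ (n * (m + 1)) := by
  by_cases hk : k < (SS n m l).count j
  swap
  · refine ⟨0, by rw [pc_eq_zero (not_lt.mp hk)]; simp, by simp⟩
  have hcount := SS_count_le n m l hl j
  set L : ℕ := Nat.lcmUpto n with hLdef
  set s := (SS n m l).count j - 1 - k with hs
  have hsm : s ≤ m := by omega
  have hkm : k ≤ m := by omega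
  have hL : ∀ a ∈ SS n m l, a ≠ j → ((j : ℤ) - a) ∣ (L : ℤ) := by
    intro a ha haj
    have han := SS_le n m l a ha
    rw [← Int.natAbs_dvd_natAbs, Int.natAbs_natCast]
    have : ((j : ℤ) - a).natAbs ∈ Finset.Icc 1 n := by
      rw [Finset.mem_Icc]; omega
    exact Finset.dvd_lcm (f := id) this
  obtain ⟨z, hz⟩ := GG_int j L (SS n m l) hL s
  have hnorm := GG_norm j (SS n m l) s
  obtain ⟨e, he, hen⟩ := wt_SS_mul j n m l hj hl
  obtain ⟨f, hf⟩ : k.factorial ∣ m.factorial := Nat.factorial_dvd_factorial hkm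
  have hkf : (k.factorial : ℂ) ≠ 0 := by exact_mod_cast Nat.factorial_ne_zero k
  have hsc : (scl n m : ℂ) = (k.factorial * f : ℂ) * (wt j (SS n m l) * e) * (L : ℂ) ^ m := by
    have he' : ((wt j (SS n m l) : ℂ) * e) = (n.factorial : ℂ) ^ (m + 1) := by exact_mod_cast he
    rw [he', scl, hf]
    push_cast
    ring
  have hform : (scl n m : ℂ) * pc j (SS n m l) k
      = f * e * L ^ m * (PowerSeries.coeff s (GG j (SS n m l)) * wt j (SS n m l)) := by
    rw [hsc, pc, if_pos hk, ← hs]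
    field_simp
  have hxint : (scl n m : ℂ) * pc j (SS n m l) k = ((f * e * L ^ (m - s) * z : ℤ) : ℂ) := by
    rw [hform]
    push_cast
    rw [← hz]
    have : (L : ℂ) ^ m = (L : ℂ) ^ (m - s) * (L : ℂ) ^ s := by
      rw [← pow_add]; congr 1; omega
    rw [this]
    push_cast
    ring
  refine ⟨_, hxint, ?_⟩
  have hn2 : |((f * e * L ^ (m - s) * z : ℤ) : ℝ)| = ‖(scl n m : ℂ) * pc j (SS n m l) k‖ := by
    rw [hxint, Complex.norm_intCast]
  rw [hn2, hform, norm_mul, norm_mul, norm_mul, norm_pow, Complex.norm_natCast, Complex.norm_natCast,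
    Complex.norm_intCast]
  have b1 : (f : ℝ) ≤ m.factorial := by
    have : f ≤ m.factorial := by
      rw [hf]; exact Nat.le_mul_of_pos_left _ (Nat.factorial_pos k)
    exact_mod_cast this
  have b2 : |(e : ℝ)| ≤ 4 ^ (n * (m + 1)) := by
    have : (e.natAbs : ℝ) ≤ 4 ^ (n * (m + 1)) := by exact_mod_cast hen
    rwa [Nat.cast_natAbs, Int.cast_abs] at this
  have b3 : (L : ℝ) ^ m ≤ 256 ^ (n * (m + 1)) := by
    calc (L : ℝ) ^ m ≤ (256 ^ n) ^ m := by gcongr; exact lcm_bound n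
      _ = 256 ^ (n * m) := by rw [pow_mul]
      _ ≤ _ := pow_le_pow_right₀ (by norm_num) (by nlinarith)
  have b4 : (2 : ℝ) ^ ((SS n m l).card + s) ≤ 2 ^ (n * (m + 1)) * 4 ^ (m + 1) := by
    rw [SS_card, show (4 : ℝ) = 2 ^ 2 by norm_num, ← pow_mul, ← pow_add]
    refine pow_le_pow_right₀ (by norm_num) ?_
    rw [mul_comm n]
    omega
  calc _ ≤ (m.factorial : ℝ) * 4 ^ (n * (m + 1)) * 256 ^ (n * (m + 1)) * (2 ^ (n * (m + 1)) * 4 ^ (m + 1)) := by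
        gcongr
        exact hnorm.trans b4
    _ = (m.factorial * 4 ^ (m + 1)) * ((4 * 256 * 2) ^ (n * (m + 1))) := by
        rw [mul_pow, mul_pow]; ring
    _ = _ := by norm_num

lemma scl_ff (n m l : ℕ) (hl : l ≤ m) (y Y : ℝ) (hy : 0 ≤ y) (hY : 1 ≤ Y) (hyY : y ≤ Y) :
    ‖(scl n m : ℂ) * ff n (m + 1) (SS n m l) y‖
      ≤ (m.factorial * Y ^ m) * (1000 * Y / ((m : ℝ) + 1)) ^ (n * (m + 1)) := by
  have hb := ff_bound n m ((m + 1) * n + l) (SS n m l) (SS_card n m l) (SS_le n m l)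
      (SS_count_le n m l (by omega)) y hy
  set N := (m + 1) * n with hN
  have hNn : n * (m + 1) = N := by rw [hN]; ring
  rw [hNn]
  have h1 : y ^ (N + l) / ((N + l).factorial : ℝ) ≤ Y ^ (N + m) / (N.factorial : ℝ) := by
    gcongr
    · calc y ^ (N + l) ≤ Y ^ (N + l) := by gcongr
        _ ≤ Y ^ (N + m) := pow_le_pow_right₀ hY (by omega)
    · omega
  have h2 : (n.factorial : ℝ) ^ (m + 1) ≤ (n : ℝ) ^ N := by
    rw [hN, mul_comm, pow_mul]
    gcongr
    exact_mod_cast Nat.factorial_le_pow n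
  have hm1 : (0 : ℝ) < (m : ℝ) + 1 := by positivity
  have h3 : (n : ℝ) ^ N / (N.factorial : ℝ) ≤ (3 / ((m : ℝ) + 1)) ^ N := by
    have h4 := Real.pow_div_factorial_le_exp (x := (N : ℝ)) (by positivity) N
    have h5 : Real.exp (N : ℝ) ≤ 3 ^ N := by
      rw [← Real.exp_one_pow]
      gcongr
      exact Real.exp_one_lt_three.le
    have h6 : (N : ℝ) ^ N = ((m : ℝ) + 1) ^ N * (n : ℝ) ^ N := by
      rw [← mul_pow, hN]; push_cast; ring
    rw [h6] at h4
    rw [div_pow, le_div_iff₀ (by positivity)]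
    refine le_trans (le_of_eq ?_) (h4.trans h5)
    ring
  have h7 : (Nat.lcmUpto n : ℝ) ^ m ≤ 256 ^ N := by
    calc (Nat.lcmUpto n : ℝ) ^ m ≤ (256 ^ n) ^ m := by gcongr; exact lcm_bound n
      _ = 256 ^ (n * m) := by rw [pow_mul]
      _ ≤ _ := pow_le_pow_right₀ (by norm_num) (by nlinarith)
  rw [norm_mul, Complex.norm_natCast, scl]
  push_cast
  calc _ ≤ (m.factorial : ℝ) * (n : ℝ) ^ N * 256 ^ N * (Y ^ (N + m) / (N.factorial : ℝ)) := by
        gcongr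
        exact hb.trans h1
    _ = (m.factorial : ℝ) * Y ^ m * ((n : ℝ) ^ N / (N.factorial : ℝ) * 256 ^ N * Y ^ N) := by
        rw [pow_add]; ring
    _ ≤ (m.factorial : ℝ) * Y ^ m * ((3 / ((m : ℝ) + 1)) ^ N * 256 ^ N * Y ^ N) := by gcongr
    _ = (m.factorial : ℝ) * Y ^ m * ((768 * Y / ((m : ℝ) + 1)) ^ N) := by
        rw [← mul_pow, ← mul_pow]; congr 2; ring
    _ ≤ _ := by gcongr; norm_num

/-- Summary of the construction. -/
lemma construction (m : ℕ) (Y : ℝ) (hY : 1 ≤ Y) : ∃ K : ℝ, 1 ≤ K ∧ ∀ n : ℕ, ∃ c : ℕ → ℕ → ℕ → ℤ,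
    (∀ l ≤ m, ∀ j ≤ n, ∀ k, |(c l j k : ℝ)| ≤ K * 2048 ^ (n * (m + 1))) ∧
    (∀ l ≤ m, ∀ y : ℝ, 0 ≤ y → y ≤ Y →
      ‖∑ j ∈ Finset.range (n + 1), ∑ k ∈ Finset.range (m + 1),
        (c l j k : ℂ) * Complex.exp (Complex.I * y) ^ j * (Complex.I * y) ^ k‖
        ≤ K * (1000 * Y / ((m : ℝ) + 1)) ^ (n * (m + 1))) ∧
    (∀ β z : ℂ, β ≠ 1 → ∃ l ≤ m, ∑ j ∈ Finset.range (n + 1), ∑ k ∈ Finset.range (m + 1),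
        (c l j k : ℂ) * β ^ j * z ^ k ≠ 0) := by
  have hfac : (1 : ℝ) ≤ m.factorial := by exact_mod_cast Nat.one_le_iff_ne_zero.mpr (Nat.factorial_ne_zero m)
  have h4 : (1 : ℝ) ≤ 4 ^ (m + 1) := one_le_pow₀ (by norm_num)
  have hYm : (1 : ℝ) ≤ Y ^ m := one_le_pow₀ hY
  refine ⟨m.factorial * 4 ^ (m + 1) * Y ^ m, ?_, fun n => ?_⟩
  · exact one_le_mul_of_one_le_of_one_le (one_le_mul_of_one_le_of_one_le hfac h4) hYm
  have hex : ∀ l j k : ℕ, ∃ z : ℤ, l ≤ m → j ≤ n → (scl n m : ℂ) * pc j (SS n m l) k = z ∧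
      |(z : ℝ)| ≤ (m.factorial * 4 ^ (m + 1)) * 2048 ^ (n * (m + 1)) := by
    intro l j k
    by_cases h : l ≤ m ∧ j ≤ n
    · obtain ⟨z, hz⟩ := scl_pc n m l j k h.2 h.1
      exact ⟨z, fun _ _ => hz⟩
    · exact ⟨0, fun h1 h2 => absurd ⟨h1, h2⟩ h⟩
  choose c hc using hex
  have hsum : ∀ l ≤ m, ∀ β z : ℂ, ∑ j ∈ Finset.range (n + 1), ∑ k ∈ Finset.range (m + 1),
        (c l j k : ℂ) * β ^ j * z ^ k
      = scl n m * ∑ j ∈ Finset.range (n + 1), ∑ k ∈ Finset.range (m + 1),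
        pc j (SS n m l) k * β ^ j * z ^ k := by
    intro l hl β z
    simp only [Finset.mul_sum]
    refine Finset.sum_congr rfl fun j hj => Finset.sum_congr rfl fun k _ => ?_
    rw [← (hc l j k hl (by have := Finset.mem_range.mp hj; omega)).1]
    ring
  refine ⟨c, ?_, ?_, ?_⟩
  · intro l hl j hj k
    refine (hc l j k hl hj).2.trans ?_
    refine mul_le_mul_of_nonneg_right ?_ (by positivity)
    exact le_mul_of_one_le_right (by positivity) hYm
  · intro l hl y hy hyY
    rw [hsum l hl]
    have e : ∑ j ∈ Finset.range (n + 1), ∑ k ∈ Finset.range (m + 1),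
        pc j (SS n m l) k * Complex.exp (Complex.I * y) ^ j * (Complex.I * y) ^ k
        = ff n (m + 1) (SS n m l) y := by
      unfold ff
      refine Finset.sum_congr rfl fun j _ => Finset.sum_congr rfl fun k _ => ?_
      rw [← Complex.exp_nat_mul]
    rw [e]
    refine (scl_ff n m l hl y Y hy hY hyY).trans ?_
    refine mul_le_mul_of_nonneg_right ?_ (by positivity)
    refine mul_le_mul_of_nonneg_right ?_ (by positivity)
    exact le_mul_of_one_le_right (by positivity) h4
  · intro β z hβ
    obtain ⟨l, hl, h⟩ := nonvanishing n m β hβ z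
    refine ⟨l, hl, ?_⟩
    rw [hsum l hl]
    refine mul_ne_zero ?_ h
    have : scl n m ≠ 0 := by
      unfold scl
      have := Nat.lcmUpto_ne_zero n
      have := Nat.factorial_ne_zero n
      have := Nat.factorial_ne_zero m
      positivity
    exact_mod_cast this

lemma norm_lower (K : IntermediateField ℚ ℂ) [FiniteDimensional ℚ K] (x : K) (hx : x ≠ 0)
    (hxint : IsIntegral ℤ x) (X : ℝ) (hX : 1 ≤ X) (hb : ∀ σ : K →ₐ[ℚ] ℂ, ‖σ x‖ ≤ X) :
    1 ≤ ‖(x : ℂ)‖ * X ^ (Fintype.card (K →ₐ[ℚ] ℂ)) := by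
  classical
  have h1 : IsIntegral ℤ (Algebra.norm ℚ x) := Algebra.isIntegral_norm ℚ hxint
  obtain ⟨z, hz⟩ := IsIntegrallyClosed.isIntegral_iff.mp h1
  have hn0 : Algebra.norm ℚ x ≠ 0 := Algebra.norm_ne_zero_iff.mpr hx
  have hz0 : z ≠ 0 := by rintro rfl; simp at hz; exact hn0 hz.symm
  have h2 := Algebra.norm_eq_prod_embeddings ℚ ℂ x
  have h3 : (1 : ℝ) ≤ ∏ σ : K →ₐ[ℚ] ℂ, ‖σ x‖ := by
    rw [← norm_prod, ← h2, ← hz]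
    simp only [eq_intCast, map_intCast, Complex.norm_intCast]
    exact_mod_cast Int.one_le_abs hz0
  let σ₀ : K →ₐ[ℚ] ℂ := K.val
  rw [← Finset.mul_prod_erase Finset.univ (fun σ : K →ₐ[ℚ] ℂ => ‖σ x‖) (Finset.mem_univ σ₀)] at h3
  refine h3.trans ?_
  refine mul_le_mul_of_nonneg_left ?_ (norm_nonneg _)
  calc _ ≤ ∏ σ ∈ Finset.univ.erase σ₀, X :=
        Finset.prod_le_prod (fun _ _ => norm_nonneg _) (fun σ _ => hb σ)
    _ = X ^ (Finset.univ.erase σ₀).card := by rw [Finset.prod_const]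
    _ ≤ _ := pow_le_pow_right₀ hX (Finset.card_le_univ _)

lemma liouville_lower (β : ℂ) (hβ : IsAlgebraic ℚ β) : ∃ (D : ℕ) (H : ℝ), 1 ≤ H ∧
    ∀ (n m : ℕ) (c : ℕ → ℕ → ℤ) (B Q : ℝ) (p q : ℤ), 1 ≤ B → 1 ≤ Q →
      (∀ j ≤ n, ∀ k, |(c j k : ℝ)| ≤ B) → |(p : ℝ)| ≤ Q → |(q : ℝ)| ≤ Q →
      (∑ j ∈ Finset.range (n + 1), ∑ k ∈ Finset.range (m + 1),
        (c j k : ℂ) * β ^ j * Complex.I ^ k * (p : ℂ) ^ k * (q : ℂ) ^ (m - k)) ≠ 0 →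
      1 ≤ ‖∑ j ∈ Finset.range (n + 1), ∑ k ∈ Finset.range (m + 1),
        (c j k : ℂ) * β ^ j * Complex.I ^ k * (p : ℂ) ^ k * (q : ℂ) ^ (m - k)‖ * H ^ n *
        (((n : ℝ) + 1) * (m + 1) * B * H ^ n * Q ^ m) ^ D := by
  have hI : IsIntegral ℤ Complex.I := by
    refine ⟨Polynomial.X ^ 2 + 1, by monicity!, by simp⟩
  have hIQ : IsAlgebraic ℚ Complex.I := (hI.tower_top (A := ℚ)).isAlgebraic
  set K : IntermediateField ℚ ℂ := IntermediateField.adjoin ℚ {β, Complex.I} with hK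
  have : FiniteDimensional ℚ K := by
    refine IntermediateField.finiteDimensional_adjoin ?_
    intro x hx
    rcases hx with h | h
    · rw [h]; exact hβ.isIntegral
    · rw [h]; exact hIQ.isIntegral
  have hβK : β ∈ K := IntermediateField.subset_adjoin _ _ (by simp)
  have hIK : Complex.I ∈ K := IntermediateField.subset_adjoin _ _ (by simp)
  set b' : K := ⟨β, hβK⟩
  set i' : K := ⟨Complex.I, hIK⟩
  have hinj : Function.Injective (algebraMap K ℂ) := (algebraMap K ℂ).injective
  have hi' : IsIntegral ℤ i' := by
    have : IsIntegral ℤ (algebraMap K ℂ i') := hI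
    exact (isIntegral_algebraMap_iff hinj).mp this
  obtain ⟨d, hd0, hd⟩ := ((IsFractionRing.isAlgebraic_iff ℤ ℚ ℂ).mpr hβ).exists_integral_multiple
  have hd' : IsIntegral ℤ ((d : K) * b') := by
    have : IsIntegral ℤ (algebraMap K ℂ ((d : K) * b')) := by
      have e : algebraMap K ℂ ((d : K) * b') = d • β := by
        simp [b']
      rw [e]; exact hd
    exact (isIntegral_algebraMap_iff hinj).mp this
  have hd1 : (1 : ℝ) ≤ |(d : ℝ)| := by exact_mod_cast Int.one_le_abs hd0
  obtain ⟨H0, hH0⟩ : ∃ H0 : ℝ, ∀ σ : K →ₐ[ℚ] ℂ, ‖σ b'‖ ≤ H0 :=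
    ⟨∑ σ : K →ₐ[ℚ] ℂ, ‖σ b'‖, fun σ =>
      Finset.single_le_sum (f := fun σ : K →ₐ[ℚ] ℂ => ‖σ b'‖) (fun _ _ => norm_nonneg _) (Finset.mem_univ σ)⟩
  set H1 := max 1 H0
  have hH1 : 1 ≤ H1 := le_max_left _ _
  refine ⟨Fintype.card (K →ₐ[ℚ] ℂ), |(d : ℝ)| * H1, one_le_mul_of_one_le_of_one_le hd1 hH1, ?_⟩
  intro n m c B Q p q hB hQ hc hp hq hne
  set S := ∑ j ∈ Finset.range (n + 1), ∑ k ∈ Finset.range (m + 1),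
        (c j k : ℂ) * β ^ j * Complex.I ^ k * (p : ℂ) ^ k * (q : ℂ) ^ (m - k) with hS
  set x : K := (d : K) ^ n * ∑ j ∈ Finset.range (n + 1), ∑ k ∈ Finset.range (m + 1),
        (c j k : K) * b' ^ j * i' ^ k * (p : K) ^ k * (q : K) ^ (m - k) with hxdef
  have hxS : (x : ℂ) = (d : ℂ) ^ n * S := by
    have : algebraMap K ℂ x = (d : ℂ) ^ n * S := by
      rw [hxdef, hS]
      simp only [map_mul, map_sum, map_pow, map_intCast]
      rfl
    exact this
  have hdC : (d : ℂ) ≠ 0 := by exact_mod_cast hd0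
  have hx0 : x ≠ 0 := by
    intro h
    rw [h] at hxS
    exact mul_ne_zero (pow_ne_zero n hdC) hne (by simpa using hxS.symm)
  have hintc : ∀ z : ℤ, IsIntegral ℤ (z : K) := fun z => by
    simpa using (isIntegral_algebraMap (R := ℤ) (A := K) (x := z))
  have hxint : IsIntegral ℤ x := by
    rw [hxdef, Finset.mul_sum]
    refine IsIntegral.sum _ fun j hj => ?_
    rw [Finset.mul_sum]
    refine IsIntegral.sum _ fun k _ => ?_
    have hjn : j ≤ n := by have := Finset.mem_range.mp hj; omega
    have e : (d : K) ^ n * ((c j k : K) * b' ^ j * i' ^ k * (p : K) ^ k * (q : K) ^ (m - k))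
        = (d : K) ^ (n - j) * ((c j k : K) * ((d : K) * b') ^ j * i' ^ k * (p : K) ^ k * (q : K) ^ (m - k)) := by
      have : (d : K) ^ n = (d : K) ^ (n - j) * (d : K) ^ j := by
        rw [← pow_add]; congr 1; omega
      rw [this]; ring
    rw [e]
    exact ((hintc d).pow _).mul (((((hintc _).mul (hd'.pow _)).mul (hi'.pow _)).mul
      ((hintc p).pow _)).mul ((hintc q).pow _))
  have hX1 : 1 ≤ ((n : ℝ) + 1) * (m + 1) * B * (|(d : ℝ)| * H1) ^ n * Q ^ m := by
    have a1 : (1 : ℝ) ≤ (n : ℝ) + 1 := by linarith [(Nat.cast_nonneg n : (0 : ℝ) ≤ n)]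
    have a2 : (1 : ℝ) ≤ (m : ℝ) + 1 := by linarith [(Nat.cast_nonneg m : (0 : ℝ) ≤ m)]
    have a3 : (1 : ℝ) ≤ (|(d : ℝ)| * H1) ^ n := one_le_pow₀ (one_le_mul_of_one_le_of_one_le hd1 hH1)
    have a4 : (1 : ℝ) ≤ Q ^ m := one_le_pow₀ hQ
    exact one_le_mul_of_one_le_of_one_le (one_le_mul_of_one_le_of_one_le
      (one_le_mul_of_one_le_of_one_le (one_le_mul_of_one_le_of_one_le a1 a2) hB) a3) a4
  have hbound : ∀ σ : K →ₐ[ℚ] ℂ, ‖σ x‖ ≤ ((n : ℝ) + 1) * (m + 1) * B * (|(d : ℝ)| * H1) ^ n * Q ^ m := by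
    intro σ
    have hσi : ‖σ i'‖ = 1 := by
      have h1 : i' ^ 2 = -1 := by
        apply hinj
        rw [map_pow, map_neg, map_one]
        exact Complex.I_sq
      have h2 : (σ i') ^ 2 = -1 := by rw [← map_pow, h1, map_neg, map_one]
      have h3 : ‖σ i'‖ ^ 2 = 1 := by rw [← norm_pow, h2]; simp
      exact (pow_eq_one_iff_of_nonneg (norm_nonneg _) two_ne_zero).mp h3
    have hσb : ‖σ b'‖ ≤ H1 := (hH0 σ).trans (le_max_right _ _)
    rw [hxdef, map_mul, map_pow, map_intCast, map_sum, norm_mul, norm_pow, Complex.norm_intCast]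
    have hterm : ‖∑ j ∈ Finset.range (n + 1), σ (∑ k ∈ Finset.range (m + 1),
        (c j k : K) * b' ^ j * i' ^ k * (p : K) ^ k * (q : K) ^ (m - k))‖
        ≤ ∑ j ∈ Finset.range (n + 1), ∑ k ∈ Finset.range (m + 1), B * H1 ^ n * Q ^ m := by
      refine norm_sum_le_of_le _ fun j hj => ?_
      rw [map_sum]
      refine norm_sum_le_of_le _ fun k hk => ?_
      have hjn : j ≤ n := by have := Finset.mem_range.mp hj; omega
      have hkm : k ≤ m := by have := Finset.mem_range.mp hk; omega
      simp only [map_mul, map_pow, map_intCast, norm_mul, norm_pow, Complex.norm_intCast, hσi, one_pow,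
        mul_one]
      have e : Q ^ m = Q ^ k * Q ^ (m - k) := by rw [← pow_add]; congr 1; omega
      rw [e, ← mul_assoc]
      have hj2 : ‖σ b'‖ ^ j ≤ H1 ^ n :=
        (pow_le_pow_left₀ (norm_nonneg _) hσb j).trans (pow_le_pow_right₀ hH1 hjn)
      have := hc j hjn k
      gcongr
    calc _ ≤ |(d : ℝ)| ^ n * ∑ j ∈ Finset.range (n + 1), ∑ k ∈ Finset.range (m + 1), B * H1 ^ n * Q ^ m := by
          gcongr
      _ = _ := by
        simp only [Finset.sum_const, Finset.card_range, nsmul_eq_mul]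
        rw [mul_pow]
        push_cast
        ring
  have hfin := norm_lower K x hx0 hxint _ hX1 hbound
  rw [hxS, norm_mul, norm_pow, Complex.norm_intCast] at hfin
  refine hfin.trans ?_
  have : |(d : ℝ)| ^ n ≤ (|(d : ℝ)| * H1) ^ n := by
    gcongr
    exact le_mul_of_one_le_right (abs_nonneg _) hH1
  rw [mul_comm (|(d : ℝ)| ^ n)]
  gcongr

lemma pow_sub_bound (z w : ℂ) (R : ℝ) (hR : 1 ≤ R) (hz : ‖z‖ ≤ R) (hw : ‖w‖ ≤ R) (k : ℕ) :
    ‖z ^ k - w ^ k‖ ≤ k * R ^ k * ‖z - w‖ := by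
  induction k with
  | zero => simp
  | succ k ih =>
    have e : z ^ (k + 1) - w ^ (k + 1) = z ^ k * (z - w) + (z ^ k - w ^ k) * w := by ring
    rw [e]
    refine (norm_add_le _ _).trans ?_
    rw [norm_mul, norm_mul, norm_pow]
    have h1 : ‖z‖ ^ k ≤ R ^ (k + 1) :=
      (pow_le_pow_left₀ (norm_nonneg _) hz k).trans (pow_le_pow_right₀ hR (by omega))
    calc _ ≤ R ^ (k + 1) * ‖z - w‖ + (k * R ^ k * ‖z - w‖) * R := by gcongr
      _ = _ := by push_cast; ring

set_option maxHeartbeats 2000000 in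
/-- The logarithm of an algebraic number of modulus one is not `i` times a positive Liouville
number. -/
theorem main_pos (θ : ℝ) (hθ : 0 < θ) (hL : Liouville θ)
    (halg : IsAlgebraic ℚ (Complex.exp (Complex.I * θ))) (hne : Complex.exp (Complex.I * θ) ≠ 1) :
    False := by
  set β := Complex.exp (Complex.I * θ) with hβ
  have hβn : ‖β‖ = 1 := by rw [hβ, mul_comm, Complex.norm_exp_ofReal_mul_I]
  obtain ⟨D, H, hH, hlow⟩ := liouville_lower β halg
  set Θ := θ + 1 with hΘ
  have hΘ1 : 1 ≤ Θ := by linarith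
  set W : ℝ := 4096 * H with hW
  have hW1 : 1 ≤ W := by linarith
  -- choice of `m`
  obtain ⟨m, hm⟩ : ∃ m : ℕ, 2 * (W ^ (D + 1) * (1000 * Θ)) ≤ m := exists_nat_ge _
  obtain ⟨K, hK, hcon⟩ := construction m Θ hΘ1
  -- the constant
  set K1 : ℝ := (m + 1) * K * Θ ^ m with hK1
  set K3 : ℝ := K1 ^ D * (K + (m + 1) * K * (m * Θ ^ m)) with hK3
  have hK1p : 0 < K1 := by positivity
  have hK3p : 0 < K3 := by positivity
  obtain ⟨κ, hκ⟩ : ∃ κ : ℕ, 4 * K3 ≤ 2 ^ κ := by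
    obtain ⟨κ, h⟩ := pow_unbounded_of_one_lt (4 * K3) (one_lt_two (α := ℝ))
    exact ⟨κ, h.le⟩
  obtain ⟨v, hv⟩ : ∃ v : ℕ, W ^ (D + 1) * 4096 ≤ 2 ^ v := by
    obtain ⟨v, h⟩ := pow_unbounded_of_one_lt (W ^ (D + 1) * 4096) (one_lt_two (α := ℝ))
    exact ⟨v, h.le⟩
  set u : ℕ := κ + m * (D + 1) with hu
  set w : ℕ := u + 2 * u * (m + 1) * v with hw
  obtain ⟨p, q, hq, -, hpq⟩ := hL w
  have hqR : (2 : ℝ) ≤ q := by exact_mod_cast hq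
  have hq0 : (0 : ℝ) < q := by linarith
  -- choice of `n`
  obtain ⟨g, hg1, hg2⟩ : ∃ g : ℕ, (q : ℝ) ≤ 2 ^ g ∧ (2 : ℝ) ^ g ≤ (q : ℝ) ^ 2 := by
    obtain ⟨g, h1, h2⟩ := exists_nat_pow_near (x := (q : ℝ)) (y := 2) (by linarith) one_lt_two
    refine ⟨g + 1, h2.le, ?_⟩
    rw [pow_succ, pow_two]
    exact mul_le_mul h1 hqR (by norm_num) (by linarith)
  set n := u * g with hn
  have hn1 : (2 : ℝ) ^ κ * (q : ℝ) ^ (m * (D + 1)) ≤ 2 ^ n := by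
    calc (2 : ℝ) ^ κ * (q : ℝ) ^ (m * (D + 1)) ≤ (q : ℝ) ^ κ * (q : ℝ) ^ (m * (D + 1)) := by gcongr
      _ = (q : ℝ) ^ u := by rw [← pow_add]
      _ ≤ (2 ^ g) ^ u := by gcongr
      _ = 2 ^ n := by rw [← pow_mul, hn, mul_comm]
  have hn2 : (2 : ℝ) ^ n ≤ (q : ℝ) ^ (2 * u) := by
    calc (2 : ℝ) ^ n = (2 ^ g) ^ u := by rw [← pow_mul, hn, mul_comm]
      _ ≤ ((q : ℝ) ^ 2) ^ u := by gcongr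
      _ = _ := by rw [← pow_mul]
  have hn3 : (n : ℝ) + 1 ≤ 2 ^ n := by
    have : n + 1 ≤ 2 ^ n := Nat.lt_two_pow_self
    exact_mod_cast this
  obtain ⟨c, hc1, hc2, hc3⟩ := hcon n
  set z : ℂ := Complex.I * (p / q : ℝ) with hz
  obtain ⟨l, hl, hlne⟩ := hc3 β z hne
  set M := n * (m + 1) with hM
  set B : ℝ := K * 2048 ^ M with hB
  have hB1 : 1 ≤ B := one_le_mul_of_one_le_of_one_le hK (one_le_pow₀ (by norm_num))
  have hnM : n ≤ M := by rw [hM]; exact Nat.le_mul_of_pos_right _ (by omega)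
  set ε : ℝ := 1 / (q : ℝ) ^ w with hε
  have hε1 : ε ≤ 1 := by
    rw [hε, div_le_one (by positivity)]
    exact one_le_pow₀ (by linarith)
  have hpqΘ : |(p / q : ℝ)| ≤ Θ := by
    have h1 : |(p / q : ℝ)| ≤ |θ| + |θ - p / q| := by
      have := abs_sub_abs_le_abs_sub (p / q : ℝ) θ
      rw [abs_sub_comm] at this
      linarith
    rw [abs_of_pos hθ] at h1
    linarith
  have hzΘ : ‖z‖ ≤ Θ := by
    rw [hz, norm_mul, Complex.norm_I, one_mul, Complex.norm_real]
    exact hpqΘ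
  have hθΘ : ‖Complex.I * (θ : ℂ)‖ ≤ Θ := by
    rw [norm_mul, Complex.norm_I, one_mul, Complex.norm_real, Real.norm_of_nonneg hθ.le]
    linarith
  have hzθ : ‖z - Complex.I * θ‖ ≤ ε := by
    rw [hz, ← mul_sub, norm_mul, Complex.norm_I, one_mul, ← Complex.ofReal_sub, Complex.norm_real,
      norm_sub_rev]
    exact hpq.le
  set T := ∑ j ∈ Finset.range (n + 1), ∑ k ∈ Finset.range (m + 1),
        (c l j k : ℂ) * β ^ j * z ^ k with hT
  have hqC : (q : ℂ) ≠ 0 := by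
    have : q ≠ 0 := by omega
    exact_mod_cast this
  have hST : ∑ j ∈ Finset.range (n + 1), ∑ k ∈ Finset.range (m + 1),
        (c l j k : ℂ) * β ^ j * Complex.I ^ k * (p : ℂ) ^ k * (q : ℂ) ^ (m - k) = (q : ℂ) ^ m * T := by
    rw [hT]
    simp only [Finset.mul_sum]
    refine Finset.sum_congr rfl fun j _ => Finset.sum_congr rfl fun k hk => ?_
    have hkm : k ≤ m := by have := Finset.mem_range.mp hk; omega
    have e : (q : ℂ) ^ m = (q : ℂ) ^ (m - k) * (q : ℂ) ^ k := by rw [← pow_add]; congr 1; omega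
    rw [e, hz]
    push_cast
    rw [mul_pow, div_pow]
    field_simp
  -- lower bound
  have hpQ : |(p : ℝ)| ≤ q * Θ := by
    rw [abs_div, abs_of_pos hq0, div_le_iff₀ hq0] at hpqΘ
    linarith
  have hqQ : |(q : ℝ)| ≤ q * Θ := by
    rw [abs_of_pos hq0]
    exact le_mul_of_one_le_right hq0.le hΘ1
  have hlo := hlow n m (c l) B (q * Θ) p q hB1
    (one_le_mul_of_one_le_of_one_le (by linarith) hΘ1) (fun j hj k => hc1 l hl j hj k) hpQ hqQ
    (by rw [hST]; exact mul_ne_zero (pow_ne_zero _ hqC) hlne)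
  rw [hST, norm_mul, norm_pow, Complex.norm_intCast, abs_of_pos hq0] at hlo
  -- upper bound for `T`
  have hTup : ‖T‖ ≤ K * (1000 * Θ / ((m : ℝ) + 1)) ^ M
      + (n + 1) * (m + 1) * (B * (m * Θ ^ m) * ε) := by
    have h1 := hc2 l hl θ hθ.le (by linarith)
    have h2 : ‖T - ∑ j ∈ Finset.range (n + 1), ∑ k ∈ Finset.range (m + 1),
        (c l j k : ℂ) * β ^ j * (Complex.I * θ) ^ k‖
        ≤ ∑ j ∈ Finset.range (n + 1), ∑ k ∈ Finset.range (m + 1), B * (m * Θ ^ m) * ε := by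
      rw [hT, ← Finset.sum_sub_distrib]
      refine norm_sum_le_of_le _ fun j hj => ?_
      rw [← Finset.sum_sub_distrib]
      refine norm_sum_le_of_le _ fun k hk => ?_
      have hjn : j ≤ n := by have := Finset.mem_range.mp hj; omega
      have hkm : k ≤ m := by have := Finset.mem_range.mp hk; omega
      rw [← mul_sub, norm_mul, norm_mul, norm_pow, hβn, one_pow, mul_one, Complex.norm_intCast,
        mul_assoc B]
      have h3 := pow_sub_bound z (Complex.I * θ) Θ hΘ1 hzΘ hθΘ k
      have h4 : (k : ℝ) * Θ ^ k ≤ m * Θ ^ m := by gcongr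
      refine mul_le_mul (hc1 l hl j hjn k) ?_ (norm_nonneg _) (by positivity)
      refine h3.trans ?_
      gcongr
    simp only [Finset.sum_const, Finset.card_range, nsmul_eq_mul] at h2
    have h5 := norm_add_le (T - ∑ j ∈ Finset.range (n + 1), ∑ k ∈ Finset.range (m + 1),
        (c l j k : ℂ) * β ^ j * (Complex.I * θ) ^ k) (∑ j ∈ Finset.range (n + 1), ∑ k ∈ Finset.range (m + 1),
        (c l j k : ℂ) * β ^ j * (Complex.I * θ) ^ k)
    rw [sub_add_cancel] at h5
    push_cast at h2
    linarith
  -- combine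
  have hHW : ((n : ℝ) + 1) * (m + 1) * B * H ^ n * (q * Θ) ^ m ≤ K1 * W ^ M * (q : ℝ) ^ m := by
    calc _ ≤ (2 : ℝ) ^ M * (m + 1) * (K * 2048 ^ M) * H ^ M * (q * Θ) ^ m := by
          have a1 : (n : ℝ) + 1 ≤ 2 ^ M := hn3.trans (pow_le_pow_right₀ (by norm_num) hnM)
          have a2 : H ^ n ≤ H ^ M := pow_le_pow_right₀ hH hnM
          gcongr
      _ = K1 * ((2 * 2048 * H) ^ M) * (q : ℝ) ^ m := by
          rw [hK1, mul_pow, mul_pow, mul_pow]; ring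
      _ = _ := by rw [hW]; norm_num
  have hHn : H ^ n ≤ W ^ M := by
    calc H ^ n ≤ W ^ n := by
          gcongr
          linarith
      _ ≤ W ^ M := pow_le_pow_right₀ hW1 hnM
  have hTup2 : ‖T‖ ≤ (K + (m + 1) * K * (m * Θ ^ m)) *
      ((1000 * Θ / ((m : ℝ) + 1)) ^ M + 4096 ^ M * ε) := by
    have hε0 : 0 ≤ ε := by positivity
    have a1 : (n : ℝ) + 1 ≤ 2 ^ M := hn3.trans (pow_le_pow_right₀ (by norm_num) hnM)
    have a2 : (n + 1) * (m + 1) * (B * (m * Θ ^ m) * ε)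
        ≤ ((m + 1) * K * (m * Θ ^ m)) * (4096 ^ M * ε) := by
      calc (n + 1) * (m + 1) * (B * (m * Θ ^ m) * ε)
          ≤ 2 ^ M * (m + 1) * (B * (m * Θ ^ m) * ε) := by gcongr
        _ = ((m + 1) * K * (m * Θ ^ m)) * ((2 * 2048) ^ M * ε) := by
          rw [hB, mul_pow]; ring
        _ = _ := by norm_num
    have p1 : 0 ≤ (1000 * Θ / ((m : ℝ) + 1)) ^ M := by positivity
    have p2 : 0 ≤ 4096 ^ M * ε := by positivity
    have p3 : 0 ≤ (m + 1) * K * (m * Θ ^ m) := by positivity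
    have p4 : 0 ≤ K := by linarith
    have key : ∀ a x y z b : ℝ, a ≤ K * x + b → b ≤ y * z → 0 ≤ y * x → 0 ≤ K * z →
        a ≤ (K + y) * (x + z) := by
      intro a x y z b g1 g2 g3 g4
      rw [add_mul, mul_add, mul_add]
      linarith
    exact key _ _ _ _ _ hTup a2 (mul_nonneg p3 p1) (mul_nonneg p4 p2)
  have hmain : 1 ≤ K3 * (q : ℝ) ^ (m * (D + 1)) *
      ((W ^ (D + 1) * (1000 * Θ) / ((m : ℝ) + 1)) ^ M + (W ^ (D + 1) * 4096) ^ M * ε) := by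
    refine hlo.trans ?_
    calc _ ≤ (q : ℝ) ^ m * ((K + (m + 1) * K * (m * Θ ^ m)) *
          ((1000 * Θ / ((m : ℝ) + 1)) ^ M + 4096 ^ M * ε)) * W ^ M *
          (K1 * W ^ M * (q : ℝ) ^ m) ^ D := by gcongr
      _ = _ := by
        rw [hK3, mul_div_assoc (W ^ (D + 1)), mul_pow (W ^ (D + 1)), mul_pow (W ^ (D + 1)),
          mul_pow (K1 * W ^ M), mul_pow K1, ← pow_mul W, ← pow_mul W, ← pow_mul (q : ℝ) m D,
          show (D + 1) * M = M + M * D by ring, show m * (D + 1) = m + m * D by ring, pow_add W,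
          pow_add (q : ℝ)]
        ring
  have hfirst : K3 * (q : ℝ) ^ (m * (D + 1)) * (W ^ (D + 1) * (1000 * Θ) / ((m : ℝ) + 1)) ^ M ≤ 1 / 4 := by
    have h1 : W ^ (D + 1) * (1000 * Θ) / ((m : ℝ) + 1) ≤ 1 / 2 := by
      rw [div_le_iff₀ (by positivity)]
      linarith
    have h2 : (W ^ (D + 1) * (1000 * Θ) / ((m : ℝ) + 1)) ^ M ≤ 1 / 2 ^ n := by
      calc _ ≤ (1 / 2 : ℝ) ^ M := by gcongr
        _ ≤ (1 / 2 : ℝ) ^ n := pow_le_pow_of_le_one (by norm_num) (by norm_num) hnM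
        _ = _ := by rw [div_pow, one_pow]
    calc _ ≤ K3 * (q : ℝ) ^ (m * (D + 1)) * (1 / 2 ^ n) := by gcongr
      _ ≤ 1 / 4 := by
        rw [mul_one_div, div_le_iff₀ (by positivity)]
        have : (4 * K3) * (q : ℝ) ^ (m * (D + 1)) ≤ 2 ^ κ * (q : ℝ) ^ (m * (D + 1)) := by gcongr
        linarith
  have hsecond : K3 * (q : ℝ) ^ (m * (D + 1)) * ((W ^ (D + 1) * 4096) ^ M * ε) ≤ 1 / 4 := by
    have h1 : (W ^ (D + 1) * 4096) ^ M ≤ (q : ℝ) ^ (2 * u * (m + 1) * v) := by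
      calc _ ≤ ((2 : ℝ) ^ v) ^ M := by gcongr
        _ = (2 ^ n) ^ ((m + 1) * v) := by rw [← pow_mul, ← pow_mul, hM]; congr 1; ring
        _ ≤ ((q : ℝ) ^ (2 * u)) ^ ((m + 1) * v) := by gcongr
        _ = _ := by rw [← pow_mul]; congr 1; ring
    have h2 : 4 * K3 ≤ (q : ℝ) ^ κ := hκ.trans (by gcongr)
    calc _ ≤ ((q : ℝ) ^ κ / 4) * (q : ℝ) ^ (m * (D + 1)) * ((q : ℝ) ^ (2 * u * (m + 1) * v) * ε) := by
          have : K3 ≤ (q : ℝ) ^ κ / 4 := by linarith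
          gcongr
      _ = ((q : ℝ) ^ w * ε) / 4 := by
          rw [hw, hu, pow_add _ (κ + _), pow_add]; ring
      _ = 1 / 4 := by
          rw [hε, mul_one_div_cancel (by positivity)]
  rw [mul_add] at hmain
  linarith

theorem main_all (θ : ℝ) (hL : Liouville θ)
    (halg : IsAlgebraic ℚ (Complex.exp (Complex.I * θ))) (hne : Complex.exp (Complex.I * θ) ≠ 1) :
    False := by
  rcases lt_trichotomy θ 0 with h | h | h
  · refine main_pos (-θ) (by linarith) ?_ ?_ ?_
    · rw [← forall_liouvilleWith_iff] at hL ⊢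
      exact fun p => (hL p).neg
    · rw [Complex.ofReal_neg, mul_neg, Complex.exp_neg]
      exact halg.inv
    · rw [Complex.ofReal_neg, mul_neg, Complex.exp_neg]
      simpa using hne
  · subst h
    simp at hne
  · exact main_pos θ h hL halg hne

theorem liouville_tan_transcendental (α : ℝ) (h : Liouville α) :
    Transcendental ℚ (Real.tan α) := by
  intro halg
  have hLW := forall_liouvilleWith_iff.mpr h
  have hI : IsAlgebraic ℚ Complex.I := by
    have : IsIntegral ℚ Complex.I := ⟨Polynomial.X ^ 2 + 1, by monicity!, by simp⟩
    exact this.isAlgebraic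
  have h1 : IsAlgebraic ℚ (1 : ℂ) := isAlgebraic_one
  by_cases hβ : Complex.exp (Complex.I * (2 * α : ℝ)) = 1
  · -- `α` is a nonzero multiple of `π`
    obtain ⟨k, hk⟩ := Complex.exp_eq_one_iff.mp hβ
    have hk' : α = k * Real.pi := by
      have h2 : (2 * Complex.I) * (α : ℂ) = (2 * Complex.I) * ((k * Real.pi : ℝ) : ℂ) := by
        push_cast at hk ⊢
        linear_combination hk
      have := mul_left_cancel₀ (mul_ne_zero two_ne_zero Complex.I_ne_zero) h2
      exact_mod_cast this
    have hk0 : k ≠ 0 := by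
      rintro rfl
      have := h.irrational
      rw [hk'] at this
      simp at this
    have hpi : Liouville Real.pi := by
      rw [← forall_liouvilleWith_iff]
      intro p
      have := hLW p
      rw [hk'] at this
      exact (LiouvilleWith.int_mul_iff hk0).mp this
    have e : Complex.exp (Complex.I * Real.pi) = -1 := by rw [mul_comm, Complex.exp_pi_mul_I]
    refine main_all Real.pi hpi ?_ ?_
    · rw [e]; exact h1.neg
    · rw [e]; norm_num
  · refine main_all (2 * α) ?_ ?_ hβ
    · rw [← forall_liouvilleWith_iff]
      intro p
      exact_mod_cast (hLW p).nat_mul two_ne_zero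
    · have ee : Complex.exp (Complex.I * (2 * α : ℝ)) = Complex.exp (α * Complex.I) ^ 2 := by
        rw [← Complex.exp_nat_mul]; push_cast; ring_nf
      by_cases hcos : Real.cos α = 0
      · have e : Complex.exp (Complex.I * (2 * α : ℝ)) = -1 := by
          rw [ee, Complex.exp_mul_I, ← Complex.ofReal_cos, ← Complex.ofReal_sin, hcos]
          have hs : Real.sin α ^ 2 = 1 := by
            have := Real.sin_sq_add_cos_sq α
            rw [hcos] at this
            linarith
          have hsC : (Real.sin α : ℂ) ^ 2 = 1 := by exact_mod_cast hs
          rw [Complex.ofReal_zero, zero_add, mul_pow, hsC, Complex.I_sq, one_mul]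
        rw [e]; exact h1.neg
      · have ht : IsAlgebraic ℚ ((Real.tan α : ℝ) : ℂ) := by
          have := halg.algebraMap (A := ℂ)
          simpa using this
        have hcC : (Real.cos α : ℂ) ≠ 0 := by exact_mod_cast hcos
        have e : Complex.exp (Complex.I * (2 * α : ℝ))
            = (1 + (Real.tan α : ℂ) * Complex.I) * (1 - (Real.tan α : ℂ) * Complex.I)⁻¹ := by
          have hne : 1 - (Real.tan α : ℂ) * Complex.I ≠ 0 := by
            intro h0
            have := congrArg Complex.re h0
            simp at this
          rw [eq_mul_inv_iff_mul_eq₀ hne, ee, Complex.exp_mul_I, ← Complex.ofReal_cos,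
            ← Complex.ofReal_sin, Real.tan_eq_sin_div_cos]
          push_cast [-Complex.ofReal_cos, -Complex.ofReal_sin]
          have hsc : (Real.sin α : ℂ) ^ 2 + (Real.cos α : ℂ) ^ 2 = 1 := by
            exact_mod_cast Real.sin_sq_add_cos_sq α
          have hI2 : Complex.I ^ 2 = -1 := Complex.I_sq
          field_simp
          generalize (Real.cos α : ℂ) = x at *
          generalize (Real.sin α : ℂ) = y at *
          linear_combination (x + y * Complex.I) * hsc - (x + y * Complex.I) * y ^ 2 * hI2
        rw [e]
        exact (h1.add (ht.mul hI)).mul ((h1.sub (ht.mul hI)).inv)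
end
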